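/- arXiv:2008.08503 — 3 statements merged into one kernel-verified Lean document; each statement's English description precedes it below -/
import Mathlib

section
/- Let k ≥ 4. For each 4-element subset S of {1,…,2k}, let w_S ∈ ℝ^{PM(2k)} be the vector indexed by the perfect matchings of K_{2k} whose entry at P is 1 if S is the union of two edges of P (i.e., exactly two edges of P have both endpoints in S) and 0 otherwise. Then the dimension of the real span of the set {w_S : S ⊆ {1,…,2k}, |S| = 4} equals 1 + (C(2k,2) − 2k) + (C(2k,4) − C(2k,3)), where C(n,r) denotes the binomial coefficient. -/
/-- A perfect matching of the complete graph on `Fin n`: a finite set of non-loop edges such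
that every vertex lies on exactly one of them. -/
def IsPM {n : ℕ} (P : Finset (Sym2 (Fin n))) : Prop :=
  (∀ e ∈ P, ¬ e.IsDiag) ∧ ∀ v : Fin n, ∃! e, e ∈ P ∧ v ∈ e

instance {n : ℕ} : DecidablePred (IsPM (n := n)) := fun _ => by
  unfold IsPM ExistsUnique; infer_instance

/-- The type of perfect matchings of the complete graph `K_n` on `Fin n`. -/
abbrev PM (n : ℕ) := {P : Finset (Sym2 (Fin n)) // IsPM P}

open Finset Module

section SubsetFunctions

variable {V : Type*} [Fintype V] [DecidableEq V]

/-- The up operator on functions of finite sets: sum over all ways to remove an element. -/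
def upOp : (Finset V → ℝ) →ₗ[ℝ] (Finset V → ℝ) where
  toFun f S := ∑ a ∈ S, f (S.erase a)
  map_add' f g := by ext S; simp [sum_add_distrib]
  map_smul' c f := by ext S; simp [mul_sum]

/-- The down operator on functions of finite sets: sum over all ways to add an element. -/
def downOp : (Finset V → ℝ) →ₗ[ℝ] (Finset V → ℝ) where
  toFun f S := ∑ a ∈ Sᶜ, f (insert a S)
  map_add' f g := by ext S; simp [sum_add_distrib]
  map_smul' c f := by ext S; simp [mul_sum]

omit [Fintype V] in
theorem upOp_apply (f : Finset V → ℝ) (S : Finset V) : upOp f S = ∑ a ∈ S, f (S.erase a) := rfl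

theorem downOp_apply (f : Finset V → ℝ) (S : Finset V) :
    downOp f S = ∑ a ∈ Sᶜ, f (insert a S) := rfl

/-- Functions supported on the finite sets of cardinality `j`. -/
def levelSpace (V : Type*) (j : ℕ) : Submodule ℝ (Finset V → ℝ) where
  carrier := {f | ∀ S, #S ≠ j → f S = 0}
  add_mem' hf hg S hS := by simp [hf S hS, hg S hS]
  zero_mem' S _ := rfl
  smul_mem' c f hf S hS := by simp [hf S hS]

omit [Fintype V] [DecidableEq V] in
theorem mem_levelSpace {j : ℕ} {f : Finset V → ℝ} :
    f ∈ levelSpace V j ↔ ∀ S, #S ≠ j → f S = 0 := Iff.rfl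

omit [Fintype V] in
theorem upOp_mem_levelSpace {j : ℕ} {f : Finset V → ℝ} (hf : f ∈ levelSpace V j) :
    upOp f ∈ levelSpace V (j + 1) := by
  intro S hS
  refine sum_eq_zero fun a ha => hf _ ?_
  have := card_erase_add_one ha
  omega

theorem downOp_mem_levelSpace {j : ℕ} {f : Finset V → ℝ} (hf : f ∈ levelSpace V (j + 1)) :
    downOp f ∈ levelSpace V j := by
  intro S hS
  refine sum_eq_zero fun a ha => hf _ ?_
  rw [card_insert_of_notMem (by simpa using ha)]
  omega

theorem downOp_upOp (f : Finset V → ℝ) (S : Finset V) :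
    downOp (upOp f) S = upOp (downOp f) S + ((Fintype.card V : ℝ) - 2 * #S) * f S := by
  have h₁ : downOp (upOp f) S = #Sᶜ * f S + ∑ a ∈ Sᶜ, ∑ b ∈ S, f ((insert a S).erase b) := by
    rw [downOp_apply, ← nsmul_eq_mul, ← sum_const, ← sum_add_distrib]
    refine sum_congr rfl fun a ha => ?_
    have ha : a ∉ S := by simpa using ha
    rw [upOp_apply, sum_insert ha, erase_insert ha]
  have h₂ : upOp (downOp f) S = #S * f S + ∑ b ∈ S, ∑ a ∈ Sᶜ, f ((insert a S).erase b) := by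
    rw [upOp_apply, ← nsmul_eq_mul, ← sum_const, ← sum_add_distrib]
    refine sum_congr rfl fun b hb => ?_
    rw [downOp_apply, compl_erase, sum_insert (by simpa using hb), insert_erase hb]
    congr 1
    refine sum_congr rfl fun a ha => ?_
    rw [erase_insert_of_ne]
    rintro rfl
    simp [hb] at ha
  have h₃ : (#Sᶜ : ℝ) + #S = Fintype.card V := by exact_mod_cast card_compl_add_card S
  rw [h₁, h₂, sum_comm, ← h₃]
  ring

theorem sum_mul_upOp (f g : Finset V → ℝ) :
    ∑ S, f S * upOp g S = ∑ S, downOp f S * g S := by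
  simp only [upOp_apply, downOp_apply, mul_sum, sum_mul]
  rw [sum_sigma', sum_sigma']
  refine sum_nbij' (fun x => ⟨x.1.erase x.2, x.2⟩) (fun x => ⟨insert x.2 x.1, x.2⟩) ?_ ?_ ?_ ?_ ?_
    <;> rintro ⟨S, a⟩ h <;> simp at h <;> simp [h]

theorem eq_zero_of_downOp_upOp_eq_zero {j : ℕ} (hj : 2 * j < Fintype.card V) {f : Finset V → ℝ}
    (hf : f ∈ levelSpace V j) (h : downOp (upOp f) = 0) : f = 0 := by
  have h₁ : ∑ S, (f S * upOp (downOp f) S + ((Fintype.card V : ℝ) - 2 * j) * (f S * f S)) = 0 := by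
    refine sum_eq_zero fun S _ => ?_
    by_cases hS : #S = j
    · have h₂ := downOp_upOp f S
      rw [h, Pi.zero_apply, hS] at h₂
      linear_combination - f S * h₂
    · simp [hf S hS]
  rw [sum_add_distrib, sum_mul_upOp, ← mul_sum] at h₁
  have h₂ : 0 ≤ ∑ S, downOp f S * downOp f S := sum_nonneg fun S _ => mul_self_nonneg _
  have h₃ : 0 ≤ ∑ S, f S * f S := sum_nonneg fun S _ => mul_self_nonneg _
  have h₄ : (0 : ℝ) < Fintype.card V - 2 * j := by
    rw [sub_pos]
    exact_mod_cast hj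
  have h₅ : ∑ S, f S * f S = 0 := by nlinarith
  ext S
  simpa using (sum_eq_zero_iff_of_nonneg fun S _ => mul_self_nonneg (f S)).1 h₅ S (mem_univ S)

theorem eq_zero_of_upOp_eq_zero {j : ℕ} (hj : 2 * j < Fintype.card V) {f : Finset V → ℝ}
    (hf : f ∈ levelSpace V j) (h : upOp f = 0) : f = 0 :=
  eq_zero_of_downOp_upOp_eq_zero hj hf (by rw [h, map_zero])

theorem exists_downOp_eq {j : ℕ} (hj : 2 * j < Fintype.card V) {f : Finset V → ℝ}
    (hf : f ∈ levelSpace V j) : ∃ g ∈ levelSpace V (j + 1), downOp g = f := by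
  let L := (downOp ∘ₗ upOp : (Finset V → ℝ) →ₗ[ℝ] _).restrict
    (p := levelSpace V j) (q := levelSpace V j)
    fun _ hg => downOp_mem_levelSpace (upOp_mem_levelSpace hg)
  have hL : Function.Injective L := by
    rw [← LinearMap.ker_eq_bot, LinearMap.ker_eq_bot']
    rintro ⟨g, hg⟩ h
    exact Subtype.ext (eq_zero_of_downOp_upOp_eq_zero hj hg (congrArg Subtype.val h))
  obtain ⟨⟨g, hg⟩, h⟩ := LinearMap.injective_iff_surjective.1 hL ⟨f, hf⟩
  exact ⟨upOp g, upOp_mem_levelSpace hg, congrArg Subtype.val h⟩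

omit [DecidableEq V] in
theorem finrank_levelSpace (j : ℕ) :
    finrank ℝ (levelSpace V j) = (Fintype.card V).choose j := by
  let e : levelSpace V j ≃ₗ[ℝ] ({S : Finset V // #S = j} → ℝ) :=
    { toFun := fun f S => f.1 S.1
      map_add' := fun _ _ => rfl
      map_smul' := fun _ _ => rfl
      invFun := fun g => ⟨fun S => if h : #S = j then g ⟨S, h⟩ else 0, fun S hS => by simp [hS]⟩
      left_inv := fun f => by
        ext S
        by_cases hS : #S = j
        · simp [hS]
        · simp [hS, f.2 S hS]
      right_inv := fun g => by
        ext S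
        simp [S.2] }
  rw [e.finrank_eq, finrank_fintype_fun_eq_card, Fintype.card_finset_len]

omit [Fintype V] in
/-- A function which is obtained on `(s + 1)`-sets by summing over proper subsets lies in the image
of the up operator. -/
theorem exists_upOp_eq_sum_ssubsets (s : ℕ) (ψ : Finset V → ℝ) :
    ∃ g ∈ levelSpace V s, ∀ S, #S = s + 1 → upOp g S = ∑ K ∈ S.ssubsets, ψ K := by
  refine ⟨fun S => if #S = s then ∑ K ∈ S.powerset, ψ K / ((s + 1 : ℕ) - #K : ℝ) else 0,
    fun S hS => by simp [hS], fun S hS => ?_⟩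
  have h₁ : ∀ a ∈ S, #(S.erase a) = s := fun a ha => by
    rw [card_erase_of_mem ha, hS, Nat.add_sub_cancel]
  rw [upOp_apply, sum_congr rfl fun a ha => if_pos (h₁ a ha),
    sum_comm' (t' := S.ssubsets) (s' := fun K => S \ K)]
  · refine sum_congr rfl fun K hK => ?_
    have hK := mem_ssubsets.1 hK
    have h₂ := card_lt_card hK
    have h₃ : ((s + 1 : ℕ) : ℝ) - #K ≠ 0 := by
      rw [sub_ne_zero]
      exact_mod_cast (by omega : s + 1 ≠ #K)
    rw [sum_const, card_sdiff_of_subset hK.1, nsmul_eq_mul, Nat.cast_sub (card_le_card hK.1), hS]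
    field_simp
  · intro a K
    simp only [mem_powerset, mem_ssubsets, mem_sdiff]
    constructor
    · rintro ⟨ha, hK⟩
      refine ⟨⟨ha, fun h => by simpa using hK h⟩, ?_⟩
      exact hK.trans_ssubset (erase_ssubset ha)
    · rintro ⟨⟨ha, haK⟩, hK⟩
      exact ⟨ha, subset_erase.2 ⟨hK.1, haK⟩⟩

omit [Fintype V] in
theorem sum_powerset_neg_one_pow_mul_inter (m : ℕ → ℝ) {S T : Finset V} (h : ¬ S ⊆ T) :
    ∑ K ∈ S.powerset, (-1) ^ #K * m #(K ∩ T) = 0 := by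
  obtain ⟨a, haS, haT⟩ := not_subset.1 h
  rw [← insert_erase haS, sum_powerset_insert (notMem_erase a S), ← sum_add_distrib]
  refine sum_eq_zero fun K hK => ?_
  have haK : a ∉ K := fun h => by simpa using mem_powerset.1 hK h
  rw [insert_inter_of_notMem haT, card_insert_of_notMem haK]
  ring

theorem finrank_map_add_finrank_ker_inf {E F : Type*} [AddCommGroup E] [Module ℝ E]
    [FiniteDimensional ℝ E] [AddCommGroup F] [Module ℝ F] (f : E →ₗ[ℝ] F) (p : Submodule ℝ E) :
    finrank ℝ (p.map f) + finrank ℝ (p ⊓ LinearMap.ker f : Submodule ℝ E) = finrank ℝ p := by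
  rw [← LinearMap.finrank_range_add_finrank_ker (f.domRestrict p), LinearMap.range_domRestrict,
    LinearMap.ker_domRestrict, ← Submodule.map_comap_subtype, Submodule.finrank_map_subtype_eq]

end SubsetFunctions

section Pairings

variable {V : Type*}

/-- Fixed-point-free involutions, i.e. perfect matchings of the complete graph on `V` recorded by
the map sending each vertex to its partner. -/
abbrev Pairing (V : Type*) := {τ : V → V // Function.Involutive τ ∧ ∀ v, τ v ≠ v}

theorem exists_pairing_of_even_card [Fintype V] (h : Even (Fintype.card V)) :
    Nonempty (Pairing V) := by
  obtain ⟨m, hm⟩ := h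
  have e : V ≃ Fin m × Bool := Fintype.equivOfCardEq (by simp [hm, mul_two])
  refine ⟨fun v => e.symm ((e v).1, !(e v).2), fun v => by simp, fun v h => ?_⟩
  have := congrArg (fun x => (e x).2) h
  simp at this

variable [Fintype V]

noncomputable instance : Fintype (Pairing V) := Fintype.ofFinite _

variable [DecidableEq V]

theorem exists_pairing_closed (hV : Even (Fintype.card V)) {S : Finset V} (hS : Even #S) :
    ∃ τ : Pairing V, ∀ v ∈ S, τ.1 v ∈ S := by
  have h₁ : Fintype.card {v // v ∈ S} = #S := Fintype.card_coe S
  have h₂ := Fintype.card_subtype_compl (fun v => v ∈ S)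
  have h₃ : #S ≤ Fintype.card V := card_le_univ S
  obtain ⟨σ⟩ := exists_pairing_of_even_card (V := {v // v ∈ S}) (h₁ ▸ hS)
  obtain ⟨ρ⟩ := exists_pairing_of_even_card (V := {v // ¬ v ∈ S})
    (by rw [h₂, h₁, Nat.even_sub h₃]; tauto)
  let e := Equiv.sumCompl (fun v => v ∈ S)
  refine ⟨⟨fun v => e (Sum.map σ.1 ρ.1 (e.symm v)), fun v => ?_, fun v h => ?_⟩, fun v hv => ?_⟩
  · simp only [Equiv.symm_apply_apply, Sum.map_map, σ.2.1.comp_self, ρ.2.1.comp_self,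
      Sum.map_id_id, id, Equiv.apply_symm_apply]
  · rw [← Equiv.eq_symm_apply] at h
    rcases hx : e.symm v with x | x <;> rw [hx] at h
    · exact σ.2.2 x (Sum.inl_injective h)
    · exact ρ.2.2 x (Sum.inr_injective h)
  · have hx : e.symm v = Sum.inl ⟨v, hv⟩ := by rw [Equiv.symm_apply_eq]; rfl
    simp only [hx, Sum.map_inl]
    exact (σ.1 ⟨v, hv⟩).2

/-- The linear map whose value at a pairing is the sum of the values at its closed sets. -/
def closedSum : (Finset V → ℝ) →ₗ[ℝ] (Pairing V → ℝ) where
  toFun f τ := ∑ S with ∀ v ∈ S, τ.1 v ∈ S, f S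
  map_add' f g := by ext; simp [sum_add_distrib]
  map_smul' c f := by ext; simp [mul_sum]

theorem closedSum_apply (f : Finset V → ℝ) (τ : Pairing V) :
    closedSum f τ = ∑ S with ∀ v ∈ S, τ.1 v ∈ S, f S := rfl

theorem closedSum_upOp (f : Finset V → ℝ) : closedSum (upOp f) = closedSum (downOp f) := by
  ext ⟨τ, hτ, hτ'⟩
  simp only [closedSum_apply, upOp_apply, downOp_apply]
  rw [sum_sigma', sum_sigma']
  have h : ∀ v, τ (τ v) = v := hτ
  refine sum_bij' (fun x _ => ⟨(x.1.erase x.2).erase (τ x.2), τ x.2⟩)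
    (fun x _ => ⟨insert (τ x.2) (insert x.2 x.1), τ x.2⟩) ?_ ?_ ?_ ?_ ?_
  · rintro ⟨S, a⟩ h
    simp only [mem_sigma, mem_filter, mem_univ, true_and, mem_compl, mem_erase] at h ⊢
    grind
  · rintro ⟨S, a⟩ h
    simp only [mem_sigma, mem_filter, mem_univ, true_and, mem_compl, mem_insert] at h ⊢
    grind
  · rintro ⟨S, a⟩ h
    simp only [mem_sigma, mem_filter, mem_univ, true_and] at h ⊢
    have : insert a (insert (τ a) ((S.erase a).erase (τ a))) = S := by ext; grind
    simp only [hτ a, this]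
  · rintro ⟨S, a⟩ h
    simp only [mem_sigma, mem_filter, mem_univ, true_and, mem_compl] at h ⊢
    have : ((insert (τ a) (insert a S)).erase (τ a)).erase a = S := by ext; grind
    simp only [hτ a, this]
  · rintro ⟨S, a⟩ h
    simp only [mem_sigma, mem_filter, mem_univ, true_and] at h ⊢
    rw [insert_erase]
    exact mem_erase.2 ⟨hτ' a, h.1 a h.2⟩

omit [Fintype V] [DecidableEq V] in
theorem even_card_of_closed (τ : Pairing V) {S : Finset V} (hS : ∀ v ∈ S, τ.1 v ∈ S) :
    Even #S := by
  have h : ∑ _v ∈ S, (1 : ZMod 2) = 0 :=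
    sum_involution (fun v _ => τ.1 v) (fun _ _ => by decide) (fun v _ _ => τ.2.2 v) hS
      (fun v _ => τ.2.1 v)
  rwa [sum_const, nsmul_one, ZMod.natCast_eq_zero_iff_even] at h

/-- The number of pairings for which both `S` and `T` are closed. -/
noncomputable def pairingCount (S T : Finset V) : ℕ :=
  #{τ : Pairing V | (∀ v ∈ S, τ.1 v ∈ S) ∧ ∀ v ∈ T, τ.1 v ∈ T}

/-- Conjugation of pairings by a permutation. -/
def Pairing.conj {V : Type*} (σ : Equiv.Perm V) (τ : Pairing V) : Pairing V :=
  ⟨fun v => σ (τ.1 (σ.symm v)), fun v => by simp [τ.2.1 _], fun v h =>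
    τ.2.2 (σ.symm v) (by rwa [← Equiv.eq_symm_apply] at h)⟩

theorem pairingCount_eq_of_perm (σ : Equiv.Perm V) {S T S' T' : Finset V}
    (hS : ∀ v, σ v ∈ S' ↔ v ∈ S) (hT : ∀ v, σ v ∈ T' ↔ v ∈ T) :
    pairingCount S T = pairingCount S' T' := by
  have h : ∀ {A A' : Finset V}, (∀ v, σ v ∈ A' ↔ v ∈ A) → ∀ τ : Pairing V,
      (∀ v ∈ A', (τ.conj σ).1 v ∈ A') ↔ ∀ v ∈ A, τ.1 v ∈ A := fun hA τ => by
    rw [← σ.forall_congr_right]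
    simp [Pairing.conj, hA]
  refine card_nbij' (Pairing.conj σ) (Pairing.conj σ.symm) ?_ ?_ ?_ ?_
  · intro τ hτ
    simpa [h hS, h hT] using hτ
  · intro τ hτ
    have hτ' : (τ.conj σ.symm).conj σ = τ := by ext; simp [Pairing.conj]
    rw [← hτ'] at hτ
    simpa [h hS, h hT] using hτ
  · intro τ _
    ext; simp [Pairing.conj]
  · intro τ _
    ext; simp [Pairing.conj]

theorem exists_perm_of_card_eq {S T S' T' : Finset V} (hS : #S = #S') (hT : #T = #T')
    (hST : #(S ∩ T) = #(S' ∩ T')) :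
    ∃ σ : Equiv.Perm V, (∀ v, σ v ∈ S' ↔ v ∈ S) ∧ ∀ v, σ v ∈ T' ↔ v ∈ T := by
  have key : ∀ c : Bool × Bool,
      Fintype.card {v // (decide (v ∈ S), decide (v ∈ T)) = c} =
      Fintype.card {v // (decide (v ∈ S'), decide (v ∈ T')) = c} := by
    have hc : ∀ (A B : Finset V) (c : Bool × Bool),
        Fintype.card {v // (decide (v ∈ A), decide (v ∈ B)) = c} =
        #((if c.1 then A else Aᶜ) ∩ (if c.2 then B else Bᶜ)) := fun A B c => by
      rw [Fintype.card_subtype]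
      congr 1
      ext v
      rcases c with ⟨_ | _, _ | _⟩ <;> simp
    have hi : ∀ A B : Finset V, #(A ∩ Bᶜ) + #(A ∩ B) = #A := fun A B => by
      rw [← sdiff_eq_inter_compl, card_sdiff_add_card_inter]
    intro c
    rw [hc, hc]
    have h₁ := hi S T
    have h₂ := hi S' T'
    have h₃ := hi T S
    have h₄ := hi T' S'
    have h₅ := hi Sᶜ T
    have h₆ := hi S'ᶜ T'
    have h₇ := card_add_card_compl S
    have h₈ := card_add_card_compl S'
    rw [inter_comm T S, inter_comm T] at h₃
    rw [inter_comm T' S', inter_comm T'] at h₄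
    rcases c with ⟨_ | _, _ | _⟩ <;> simp <;> omega
  let σ : V ≃ V := Equiv.ofFiberEquiv fun c => Fintype.equivOfCardEq (key c)
  have hσ : ∀ v, (decide (σ v ∈ S'), decide (σ v ∈ T')) = (decide (v ∈ S), decide (v ∈ T)) :=
    Equiv.ofFiberEquiv_map (g := fun v => (decide (v ∈ S'), decide (v ∈ T')))
      fun c => Fintype.equivOfCardEq (key c)
  refine ⟨σ, fun v => ?_, fun v => ?_⟩
  · simpa using congrArg Prod.fst (hσ v)
  · simpa using congrArg Prod.snd (hσ v)

/-- The number of pairings closing two `r`-sets depends only on the size of their intersection. -/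
theorem exists_pairingCount_eq (V : Type*) [Fintype V] [DecidableEq V] (r : ℕ) :
    ∃ m : ℕ → ℕ, (∀ S T : Finset V, #S = r → #T = r → pairingCount S T = m #(S ∩ T)) ∧
      ∀ i, ¬ Even i → m i = 0 := by
  classical
  let Q : ℕ → Finset V × Finset V → Prop := fun i x => #x.1 = r ∧ #x.2 = r ∧ #(x.1 ∩ x.2) = i
  refine ⟨fun i => if h : ∃ x, Q i x then pairingCount h.choose.1 h.choose.2 else 0, ?_, ?_⟩
  · intro S T hS hT
    have h : ∃ x, Q #(S ∩ T) x := ⟨(S, T), hS, hT, rfl⟩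
    obtain ⟨h₁, h₂, h₃⟩ := h.choose_spec
    obtain ⟨σ, hσ, hσ'⟩ := exists_perm_of_card_eq (hS.trans h₁.symm) (hT.trans h₂.symm) h₃.symm
    simp only [dif_pos h]
    exact pairingCount_eq_of_perm σ hσ hσ'
  · intro i hi
    by_cases h : ∃ x, Q i x
    · obtain ⟨h₁, h₂, h₃⟩ := h.choose_spec
      simp only [dif_pos h]
      refine card_eq_zero.2 (filter_eq_empty_iff.2 fun τ _ hτ => hi ?_)
      rw [← h₃]
      refine even_card_of_closed τ fun v hv => ?_
      rw [mem_inter] at hv ⊢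
      exact ⟨hτ.1 v hv.1, hτ.2 v hv.2⟩
    · simp only [dif_neg h]

theorem sum_pairingCount_mul_eq_zero {f : Finset V → ℝ} (hf : closedSum f = 0) (S : Finset V) :
    ∑ T, (pairingCount S T : ℝ) * f T = 0 := by
  have h : ∑ τ : Pairing V with ∀ v ∈ S, τ.1 v ∈ S, closedSum f τ = 0 := by simp [hf]
  rw [← h]
  simp only [closedSum_apply, pairingCount, ← filter_filter, card_filter, Nat.cast_sum, sum_mul]
  rw [sum_comm]
  refine sum_congr rfl fun τ _ => ?_
  simp [sum_filter]

/-- A function on `(s + 1)`-sets in the kernel of `closedSum` lies in the image of `upOp`. -/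
theorem exists_upOp_eq_of_closedSum_eq_zero (hV : Even (Fintype.card V)) {s : ℕ}
    (hs : Even (s + 1)) (hsV : s + 1 ≤ Fintype.card V) {f : Finset V → ℝ}
    (hf : f ∈ levelSpace V (s + 1)) (hf₀ : closedSum f = 0) :
    ∃ g ∈ levelSpace V s, upOp g = f := by
  obtain ⟨m, hm, hm₀⟩ := exists_pairingCount_eq V (s + 1)
  set Δ : ℝ := ∑ i ∈ range (s + 1 + 1), ((s + 1).choose i) • ((-1) ^ i * (m i : ℝ)) with hΔ
  have hΔ₀ : Δ ≠ 0 := by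
    refine ne_of_gt (sum_pos' (fun i _ => ?_) ⟨s + 1, by simp, ?_⟩)
    · by_cases hi : Even i
      · rw [hi.neg_one_pow]
        positivity
      · simp [hm₀ i hi]
    · obtain ⟨S, -, hS⟩ := exists_subset_card_eq (s := (univ : Finset V)) (n := s + 1)
        (by rwa [card_univ])
      obtain ⟨τ, hτ⟩ := exists_pairing_closed hV (S := S) (by rwa [hS])
      have h : 0 < pairingCount S S := card_pos.2 ⟨τ, by simpa using hτ⟩
      rw [hm S S hS hS, inter_self, hS] at h
      rw [hs.neg_one_pow]
      simpa using h
  let φ : Finset V → ℝ := fun K => (-1) ^ #K * ∑ T, (m #(K ∩ T) : ℝ) * f T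
  have hφ : ∀ S : Finset V, #S = s + 1 → ∑ K ∈ S.ssubsets, φ K = Δ * f S := by
    intro S hS
    have h₁ : φ S = 0 := by
      have h : ∑ T, (m #(S ∩ T) : ℝ) * f T = 0 := by
        rw [← sum_pairingCount_mul_eq_zero hf₀ S]
        refine sum_congr rfl fun T _ => ?_
        by_cases hT : #T = s + 1
        · rw [hm S T hS hT]
        · simp [hf T hT]
      simp [φ, h]
    have h₂ : ∑ K ∈ S.ssubsets, φ K = ∑ K ∈ S.powerset, φ K := by
      rw [ssubsets, sum_erase _ h₁]
    rw [h₂]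
    simp only [φ, mul_sum]
    rw [sum_comm, sum_eq_single S]
    · rw [hΔ, ← hS, ← sum_powerset_apply_card (fun i => (-1 : ℝ) ^ i * (m i : ℝ)), sum_mul]
      refine sum_congr rfl fun K hK => ?_
      rw [inter_eq_left.2 (mem_powerset.1 hK), mul_assoc]
    · intro T _ hTS
      by_cases hT : #T = s + 1
      · simp only [← mul_assoc, ← sum_mul]
        rw [sum_powerset_neg_one_pow_mul_inter (fun i => (m i : ℝ)), zero_mul]
        exact fun h => hTS (eq_of_subset_of_card_le h (by omega)).symm
      · simp [hf T hT]
    · simp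
  obtain ⟨g, hg, hgS⟩ := exists_upOp_eq_sum_ssubsets s fun K => Δ⁻¹ * φ K
  refine ⟨g, hg, funext fun S => ?_⟩
  by_cases hS : #S = s + 1
  · rw [hgS S hS, ← mul_sum, hφ S hS, inv_mul_cancel_left₀ hΔ₀]
  · rw [hf S hS, upOp_mem_levelSpace hg S hS]

theorem finrank_ker_closedSum_zero (hV : Even (Fintype.card V)) :
    finrank ℝ (levelSpace V 0 ⊓ LinearMap.ker closedSum : Submodule ℝ (Finset V → ℝ)) = 0 := by
  rw [Submodule.finrank_eq_zero, eq_bot_iff]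
  rintro f ⟨hf, hf₀⟩
  obtain ⟨τ⟩ := exists_pairing_of_even_card hV
  have h : closedSum f τ = 0 := congrFun hf₀ τ
  rw [closedSum_apply, sum_eq_single ∅ (fun S _ hS => hf S (by simpa using hS)) (by simp)] at h
  refine funext fun S => ?_
  by_cases hS : #S = 0
  · rwa [card_eq_zero.1 hS]
  · exact hf S hS

theorem finrank_ker_closedSum_add_two (hV : Even (Fintype.card V)) {q : ℕ} (hq : Even q)
    (hqV : 2 * (q + 1) < Fintype.card V) :
    finrank ℝ (levelSpace V (q + 2) ⊓ LinearMap.ker closedSum : Submodule ℝ (Finset V → ℝ)) +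
        (Fintype.card V).choose q =
      finrank ℝ (levelSpace V q ⊓ LinearMap.ker closedSum : Submodule ℝ (Finset V → ℝ)) +
        (Fintype.card V).choose (q + 1) := by
  let A : Submodule ℝ (Finset V → ℝ) := levelSpace V (q + 1) ⊓ LinearMap.ker (closedSum ∘ₗ upOp)
  have hA : ∀ f, f ∈ A ↔ f ∈ levelSpace V (q + 1) ∧ closedSum (upOp f) = 0 := fun f => Iff.rfl
  have h_up : A.map upOp = levelSpace V (q + 2) ⊓ LinearMap.ker closedSum := by
    ext f
    constructor
    · rintro ⟨g, hg, rfl⟩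
      exact ⟨upOp_mem_levelSpace hg.1, hg.2⟩
    · rintro ⟨hf, hf₀⟩
      obtain ⟨g, hg, rfl⟩ := exists_upOp_eq_of_closedSum_eq_zero hV (s := q + 1)
        (hq.add even_two) (by omega) hf hf₀
      exact ⟨g, ⟨hg, hf₀⟩, rfl⟩
  have h_up_ker : A ⊓ LinearMap.ker upOp = ⊥ := by
    rw [eq_bot_iff]
    rintro f ⟨hf, hf₀⟩
    exact eq_zero_of_upOp_eq_zero hqV hf.1 hf₀
  have h_down : A.map downOp = levelSpace V q ⊓ LinearMap.ker closedSum := by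
    ext f
    constructor
    · rintro ⟨g, hg, rfl⟩
      exact ⟨downOp_mem_levelSpace hg.1, (closedSum_upOp g).symm.trans hg.2⟩
    · rintro ⟨hf, hf₀⟩
      obtain ⟨g, hg, rfl⟩ := exists_downOp_eq (by omega) hf
      exact ⟨g, ⟨hg, (closedSum_upOp g).trans hf₀⟩, rfl⟩
  have h_down_level : (levelSpace V (q + 1)).map downOp = levelSpace V q := by
    ext f
    constructor
    · rintro ⟨g, hg, rfl⟩
      exact downOp_mem_levelSpace hg
    · intro hf
      obtain ⟨g, hg, rfl⟩ := exists_downOp_eq (by omega) hf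
      exact ⟨g, hg, rfl⟩
  have h_down_ker : A ⊓ LinearMap.ker downOp = levelSpace V (q + 1) ⊓ LinearMap.ker downOp := by
    ext f
    constructor
    · exact fun hf => ⟨hf.1.1, hf.2⟩
    · rintro ⟨hf, hf₀⟩
      refine ⟨(hA f).2 ⟨hf, ?_⟩, hf₀⟩
      rw [closedSum_upOp, LinearMap.mem_ker.1 hf₀, map_zero]
  have h₁ := finrank_map_add_finrank_ker_inf upOp A
  have h₂ := finrank_map_add_finrank_ker_inf downOp A
  have h₃ := finrank_map_add_finrank_ker_inf downOp (levelSpace V (q + 1))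
  rw [h_up, h_up_ker, finrank_bot] at h₁
  rw [h_down, h_down_ker] at h₂
  rw [h_down_level, finrank_levelSpace, finrank_levelSpace] at h₃
  omega

theorem finrank_map_closedSum_four (hV : Even (Fintype.card V)) (hV₆ : 6 < Fintype.card V) :
    finrank ℝ ((levelSpace V 4).map closedSum) + Fintype.card V + (Fintype.card V).choose 3 =
      (Fintype.card V).choose 4 + (Fintype.card V).choose 2 + 1 := by
  have h₀ := finrank_ker_closedSum_zero hV
  have h₂ := finrank_ker_closedSum_add_two hV (q := 0) Even.zero (by omega)
  have h₄ := finrank_ker_closedSum_add_two hV (q := 2) even_two (by omega)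
  have h := finrank_map_add_finrank_ker_inf closedSum (levelSpace V 4)
  rw [finrank_levelSpace] at h
  simp only [zero_add, Nat.reduceAdd, Nat.choose_zero_right, Nat.choose_one_right] at h₂ h₄
  omega

theorem closedSum_single (S : Finset V) (τ : Pairing V) :
    closedSum (Pi.single S (1 : ℝ)) τ = if ∀ v ∈ S, τ.1 v ∈ S then 1 else 0 := by
  simp [closedSum_apply, Pi.single_apply]

theorem map_closedSum_levelSpace (j : ℕ) :
    (levelSpace V j).map closedSum =
      Submodule.span ℝ ((fun S => closedSum (Pi.single S (1 : ℝ))) '' {S : Finset V | #S = j}) := by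
  refine le_antisymm ?_ (Submodule.span_le.2 ?_)
  · rintro _ ⟨f, hf, rfl⟩
    have hf' : f = ∑ S, f S • Pi.single S (1 : ℝ) := by
      ext T
      simp [Finset.sum_apply, Pi.single_apply]
    rw [hf', map_sum]
    refine Submodule.sum_mem _ fun S _ => ?_
    rw [map_smul]
    by_cases hS : #S = j
    · exact Submodule.smul_mem _ _ (Submodule.subset_span ⟨S, hS, rfl⟩)
    · simp [hf S hS]
  · rintro _ ⟨S, hS, rfl⟩
    refine ⟨Pi.single S 1, fun T hT => ?_, rfl⟩
    rw [Pi.single_apply, if_neg]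
    rintro rfl
    exact hT hS

end Pairings

section PerfectMatchings

variable {n : ℕ}

/-- The perfect matching consisting of the edges joining each vertex to its partner. -/
def Pairing.toPM (τ : Pairing (Fin n)) : PM n := by
  refine ⟨univ.image fun v => s(v, τ.1 v), fun e he => ?_, fun v => ?_⟩
  · obtain ⟨v, -, rfl⟩ := mem_image.1 he
    exact fun h => τ.2.2 v (Sym2.mk_isDiag_iff.1 h).symm
  · refine ⟨s(v, τ.1 v), ⟨mem_image_of_mem _ (mem_univ v), Sym2.mem_mk_left _ _⟩, ?_⟩
    rintro e ⟨he, hv⟩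
    obtain ⟨w, -, rfl⟩ := mem_image.1 he
    rcases Sym2.mem_iff.1 hv with rfl | rfl
    · rfl
    · rw [τ.2.1 w, Sym2.eq_swap]

theorem Pairing.mk_mem_toPM (τ : Pairing (Fin n)) (v : Fin n) : s(v, τ.1 v) ∈ τ.toPM.1 :=
  mem_image_of_mem _ (mem_univ v)

theorem PM.eq_of_mem (P : PM n) {v : Fin n} {e e' : Sym2 (Fin n)} (he : e ∈ P.1) (hv : v ∈ e)
    (he' : e' ∈ P.1) (hv' : v ∈ e') : e = e' :=
  (P.2.2 v).unique ⟨he, hv⟩ ⟨he', hv'⟩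

theorem Pairing.toPM_bijective : Function.Bijective (Pairing.toPM (n := n)) := by
  constructor
  · intro τ ρ h
    ext v : 2
    have h₁ := τ.mk_mem_toPM v
    rw [h] at h₁
    exact Sym2.congr_right.1 (ρ.toPM.eq_of_mem h₁ (Sym2.mem_mk_left _ _) (ρ.mk_mem_toPM v)
      (Sym2.mem_mk_left _ _))
  · intro P
    have h : ∀ v, ∃ w, s(v, w) ∈ P.1 := fun v => by
      obtain ⟨e, ⟨he, w, rfl⟩, -⟩ := P.2.2 v
      exact ⟨w, he⟩
    choose τ hτ using h
    refine ⟨⟨τ, fun v => ?_, fun v hv => P.2.1 _ (hτ v) (Sym2.mk_isDiag_iff.2 hv.symm)⟩, ?_⟩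
    · have := P.eq_of_mem (hτ v) (Sym2.mem_mk_right _ _) (hτ (τ v)) (Sym2.mem_mk_left _ _)
      rw [Sym2.eq_swap] at this
      exact (Sym2.congr_right.1 this).symm
    · refine Subtype.ext (Finset.ext fun e => ⟨fun he => ?_, fun he => ?_⟩)
      · obtain ⟨v, -, rfl⟩ := mem_image.1 he
        exact hτ v
      · induction e with | _ v w =>
        rw [P.eq_of_mem he (Sym2.mem_mk_left _ _) (hτ v) (Sym2.mem_mk_left _ _)]
        exact mem_image_of_mem _ (mem_univ v)

theorem Pairing.exists_edges_iff_closed (τ : Pairing (Fin n)) {S : Finset (Fin n)} (hS : #S = 4) :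
    (∃ e₁ ∈ τ.toPM.1, ∃ e₂ ∈ τ.toPM.1, e₁ ≠ e₂ ∧ ∀ v : Fin n, (v ∈ S ↔ (v ∈ e₁ ∨ v ∈ e₂))) ↔
      ∀ v ∈ S, τ.1 v ∈ S := by
  constructor
  · rintro ⟨e₁, he₁, e₂, he₂, -, h⟩ v hv
    have h_mem : ∀ e ∈ τ.toPM.1, v ∈ e → τ.1 v ∈ e := fun e he hve => by
      rw [τ.toPM.eq_of_mem he hve (τ.mk_mem_toPM v) (Sym2.mem_mk_left _ _)]
      exact Sym2.mem_mk_right _ _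
    exact (h _).2 (((h v).1 hv).imp (h_mem e₁ he₁) (h_mem e₂ he₂))
  · intro h
    obtain ⟨a, ha⟩ : S.Nonempty := card_pos.1 (by omega)
    obtain ⟨b, hb, hb'⟩ := exists_mem_notMem_of_card_lt_card (s := {a, τ.1 a}) (t := S)
      (card_le_two.trans_lt (by omega))
    have hba : b ≠ a := by grind
    have hbτ : b ≠ τ.1 a := by grind
    have hτba : τ.1 b ≠ a := fun h => hbτ (by rw [← h, τ.2.1 b])
    have hτbτ : τ.1 b ≠ τ.1 a := fun h => hba (τ.2.1.injective h)
    have hSeq : ({a, τ.1 a, b, τ.1 b} : Finset (Fin n)) = S := by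
      refine eq_of_subset_of_card_le ?_ (le_of_eq ?_)
      · simp [insert_subset_iff, ha, hb, h a ha, h b hb]
      · rw [hS, card_insert_of_notMem, card_insert_of_notMem, card_insert_of_notMem,
          card_singleton]
        · simpa using (τ.2.2 b).symm
        · simp [hbτ.symm, hτbτ.symm]
        · simp [(τ.2.2 a).symm, hba.symm, hτba.symm]
    refine ⟨_, τ.mk_mem_toPM a, _, τ.mk_mem_toPM b, fun heq => ?_, fun v => ?_⟩
    · have := heq ▸ Sym2.mem_mk_left b (τ.1 b)
      simp [hba, hbτ] at this
    · rw [← hSeq]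
      simp [or_assoc]

end PerfectMatchings

open scoped Classical in
/-- Let `k ≥ 4`.  For a `4`-element set `S` of vertices, let `w_S` be the 0/1 vector, indexed
by the perfect matchings of `K_{2k}`, whose entry at `P` is `1` exactly when `S` is the union
of two edges of `P`.  The real span of all the vectors `w_S` has dimension
`1 + (C(2k,2) - 2k) + (C(2k,4) - C(2k,3))`. -/
theorem dim_span_four_sets (k : ℕ) (hk : 4 ≤ k) :
    Module.finrank ℝ (Submodule.span ℝ
      {w : PM (2 * k) → ℝ | ∃ S : Finset (Fin (2 * k)), S.card = 4 ∧
        w = fun P : PM (2 * k) =>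
          if ∃ e₁ ∈ P.1, ∃ e₂ ∈ P.1, e₁ ≠ e₂ ∧
              ∀ v : Fin (2 * k), (v ∈ S ↔ (v ∈ e₁ ∨ v ∈ e₂))
          then (1 : ℝ) else 0}) =
    1 + (Nat.choose (2 * k) 2 - 2 * k) + (Nat.choose (2 * k) 4 - Nat.choose (2 * k) 3) := by
  have hcard := finrank_map_closedSum_four (V := Fin (2 * k))
    (by rw [Fintype.card_fin]; exact even_two_mul k) (by rw [Fintype.card_fin]; omega)
  have h₁ : 2 * k ≤ (2 * k).choose 2 := by
    simpa using Nat.choose_le_succ_of_lt_half_left (r := 1) (n := 2 * k) (by omega)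
  have h₂ : (2 * k).choose 3 ≤ (2 * k).choose 4 :=
    Nat.choose_le_succ_of_lt_half_left (by omega)
  let e : (PM (2 * k) → ℝ) ≃ₗ[ℝ] (Pairing (Fin (2 * k)) → ℝ) :=
    LinearEquiv.funCongrLeft ℝ ℝ (Equiv.ofBijective _ Pairing.toPM_bijective)
  have he : ∀ w τ, e w τ = w τ.toPM := fun _ _ => rfl
  rw [Fintype.card_fin, map_closedSum_levelSpace] at hcard
  trans finrank ℝ (Submodule.span ℝ
    ((fun S => closedSum (Pi.single S (1 : ℝ))) '' {S : Finset (Fin (2 * k)) | #S = 4}))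
  · rw [← e.finrank_map_eq, Submodule.map_span]
    refine congrArg (fun A => finrank ℝ (Submodule.span ℝ A)) (Set.ext fun w => ?_)
    constructor
    · rintro ⟨_, ⟨S, hS, rfl⟩, rfl⟩
      refine ⟨S, hS, funext fun τ => ?_⟩
      simp only [closedSum_single, LinearEquiv.coe_coe, he, τ.exists_edges_iff_closed hS]
      congr
    · rintro ⟨S, hS, rfl⟩
      refine ⟨_, ⟨S, hS, rfl⟩, funext fun τ => ?_⟩
      simp only [closedSum_single, LinearEquiv.coe_coe, he, τ.exists_edges_iff_closed hS]
      congr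
  · omega
end

section
/- Let k ≥ 4. For each pair of disjoint edges e₁, e₂ of K_{2k}, let ν_{e₁,e₂} ∈ ℝ^{PM(2k)} be the vector indexed by the perfect matchings of K_{2k} whose entry at P is 1 if P contains both e₁ and e₂ and 0 otherwise. Then the dimension of the real span of the set {ν_{e₁,e₂} : e₁, e₂ disjoint edges of K_{2k}} equals 1 + (C(2k,2) − 2k) + (C(2k,4) − C(2k,3)) + (2k)(2k−1)(2k−4)(2k−5)/12, where C(n,r) denotes the binomial coefficient. -/
open Finset

/-- `IsMatchingVector S x` says that `x` is the indicator vector of a perfect matching of the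
complete graph on the vertex set `S`. -/
inductive IsMatchingVector {n : ℕ} : Finset (Fin n) → (Sym2 (Fin n) → ℝ) → Prop
  | nil : IsMatchingVector ∅ 0
  | cons {S : Finset (Fin n)} {x : Sym2 (Fin n) → ℝ} (a b : Fin n) (hab : a ≠ b) (ha : a ∉ S)
      (hb : b ∉ S) (hx : IsMatchingVector S x) :
      IsMatchingVector (insert a (insert b S)) (x + Pi.single s(a, b) 1)

namespace IsMatchingVector

variable {n : ℕ} {S : Finset (Fin n)} {x : Sym2 (Fin n) → ℝ}

theorem cons_of_eq (hx : IsMatchingVector S x) {T : Finset (Fin n)} (a b : Fin n) (hab : a ≠ b)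
    (ha : a ∉ S) (hb : b ∉ S) (hT : T = insert a (insert b S)) :
    IsMatchingVector T (x + Pi.single s(a, b) 1) :=
  hT ▸ cons a b hab ha hb hx

theorem cons_sdiff {a b : Fin n} {l : List (Fin n)}
    (hx : IsMatchingVector (univ \ (a :: b :: l).toFinset) x) (hl : (a :: b :: l).Nodup) :
    IsMatchingVector (univ \ l.toFinset) (x + Pi.single s(a, b) 1) := by
  simp only [List.nodup_cons, List.mem_cons, not_or] at hl
  refine hx.cons_of_eq a b hl.1.1 (by simp) (by simp) ?_
  ext v
  simp only [mem_sdiff, mem_univ, true_and, List.mem_toFinset, List.mem_cons, mem_insert]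
  by_cases h₁ : v = a
  · simp [h₁, hl.1.2]
  · by_cases h₂ : v = b
    · simp [h₂, hl.2.1]
    · simp [h₁, h₂]

theorem exists_of_even (S : Finset (Fin n)) (hS : Even #S) : ∃ x, IsMatchingVector S x := by
  induction hm : #S using Nat.strong_induction_on generalizing S with
  | _ m ih =>
    rcases S.eq_empty_or_nonempty with rfl | hne
    · exact ⟨0, nil⟩
    · have h1 : 1 < #S := by
        have := hne.card_pos
        obtain ⟨j, hj⟩ := hS
        omega
      obtain ⟨a, ha, b, hb, hab⟩ := Finset.one_lt_card.1 h1
      have hb' : b ∈ S.erase a := mem_erase.2 ⟨hab.symm, hb⟩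
      have hcard : #((S.erase a).erase b) = #S - 2 := by
        rw [card_erase_of_mem hb', card_erase_of_mem ha]; omega
      obtain ⟨x, hx⟩ := ih (#S - 2) (by omega) ((S.erase a).erase b)
        (by rw [hcard]; exact hS.tsub (by decide)) hcard
      refine ⟨_, hx.cons_of_eq a b hab (by simp) (by simp) ?_⟩
      rw [insert_erase hb', insert_erase ha]

theorem exists_finset (hx : IsMatchingVector S x) :
    ∃ P : Finset (Sym2 (Fin n)), x = ∑ e ∈ P, Pi.single e 1 ∧
      (∀ e ∈ P, ¬ e.IsDiag ∧ ∀ v ∈ e, v ∈ S) ∧ ∀ v ∈ S, ∃! e, e ∈ P ∧ v ∈ e := by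
  induction hx with
  | nil => exact ⟨∅, by simp⟩
  | @cons S x a b hab ha hb hx ih =>
    obtain ⟨P, rfl, hP, hS⟩ := ih
    have hnot : s(a, b) ∉ P := fun h => ha ((hP _ h).2 a (by simp))
    refine ⟨insert s(a, b) P, ?_, ?_, ?_⟩
    · rw [sum_insert hnot, add_comm]
    · intro e he
      rcases mem_insert.1 he with rfl | he
      · simp [hab]
      · exact ⟨(hP e he).1, fun v hv => by simp [(hP e he).2 v hv]⟩
    · intro v hv
      by_cases hvab : v ∈ s(a, b)
      · refine ⟨s(a, b), ⟨by simp, hvab⟩, ?_⟩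
        rintro e ⟨he, hve⟩
        rcases mem_insert.1 he with rfl | he
        · rfl
        · have := (hP e he).2 v hve
          rcases Sym2.mem_iff.1 hvab with rfl | rfl <;> contradiction
      · have hvS : v ∈ S := by
          rw [Sym2.mem_iff] at hvab
          simpa [not_or.1 hvab] using hv
        obtain ⟨e, ⟨he, hve⟩, huniq⟩ := hS v hvS
        refine ⟨e, ⟨by simp [he], hve⟩, ?_⟩
        rintro e' ⟨he', hve'⟩
        rcases mem_insert.1 he' with rfl | he'
        · contradiction
        · exact huniq e' ⟨he', hve'⟩

/-- A linear form taking the same value `D` on all edges inside `S` takes on a perfect matching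
of `S` a value which is a multiple of `D`, and a nonzero multiple if `S` is nonempty. -/
theorem exists_nat_mul (hx : IsMatchingVector S x) (φ : (Sym2 (Fin n) → ℝ) →ₗ[ℝ] ℝ) (D : ℝ)
    (hφ : ∀ a b, a ∈ S → b ∈ S → a ≠ b → φ (Pi.single s(a, b) 1) = D) :
    ∃ j : ℕ, φ x = j * D ∧ (S.Nonempty → 0 < j) := by
  induction hx with
  | nil => exact ⟨0, by simp⟩
  | @cons S x a b hab ha hb hx ih =>
    obtain ⟨j, hj, -⟩ := ih fun c d hc hd => hφ c d (by simp [hc]) (by simp [hd])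
    refine ⟨j + 1, ?_, fun _ => by omega⟩
    rw [map_add, hj, hφ a b (by simp) (by simp) hab]
    push_cast; ring

end IsMatchingVector

/-- The bilinear form on edge vectors whose matrix is `g`. -/
noncomputable def edgeForm {n : ℕ} (g : Sym2 (Fin n) → Sym2 (Fin n) → ℝ) :
    LinearMap.BilinForm ℝ (Sym2 (Fin n) → ℝ) :=
  Matrix.toBilin' (Matrix.of g)

@[simp]
theorem edgeForm_single {n : ℕ} (g : Sym2 (Fin n) → Sym2 (Fin n) → ℝ) (e e' : Sym2 (Fin n)) :
    edgeForm g (Pi.single e 1) (Pi.single e' 1) = g e e' := by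
  exact Matrix.toBilin'_single (Matrix.of g) e e'

theorem IsMatchingVector.edgeForm_self_eq_zero {n : ℕ} {g : Sym2 (Fin n) → Sym2 (Fin n) → ℝ}
    (hg : ∀ P : PM n, ∑ e ∈ P.1, ∑ e' ∈ P.1, g e e' = 0) {x : Sym2 (Fin n) → ℝ}
    (hx : IsMatchingVector univ x) : edgeForm g x x = 0 := by
  obtain ⟨P, rfl, hP, hS⟩ := hx.exists_finset
  rw [← hg ⟨P, fun e he => (hP e he).1, fun v => hS v (mem_univ v)⟩]
  simp [map_sum, LinearMap.sum_apply]
  exact Finset.sum_comm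

theorem exists_notMem_of_length_lt {n : ℕ} (l : List (Fin n)) (hl : l.length < n) :
    ∃ v, v ∉ l := by
  by_contra! h
  have h1 : (univ : Finset (Fin n)) ⊆ l.toFinset := fun v _ => List.mem_toFinset.2 (h v)
  have h2 := card_le_card h1
  have h3 := l.toFinset_card_le
  rw [card_univ, Fintype.card_fin] at h2
  omega

/-- A symmetric function of two vertices of a set which does not change when one of the two
vertices is moved is constant. -/
theorem eq_of_eq_of_move {V : Type*} {s : V → Prop} {φ : V → V → ℝ}
    (hsymm : ∀ x y, φ x y = φ y x)
    (hmove : ∀ x y z, s x → s y → s z → x ≠ y → z ≠ y → x ≠ z → φ x y = φ z y)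
    {x y z w : V} (hx : s x) (hy : s y) (hz : s z) (hw : s w) (hxy : x ≠ y) (hzw : z ≠ w) :
    φ x y = φ z w := by
  have hmove' : ∀ x y z, s x → s y → s z → x ≠ y → z ≠ y → φ x y = φ z y := by
    intro x y z hx hy hz h1 h2
    by_cases h : x = z
    · rw [h]
    · exact hmove x y z hx hy hz h1 h2 h
  by_cases hzy : z = y
  · subst hzy
    rw [hsymm x z, hsymm z x, hmove' x z w hx hz hw hxy hzw.symm, hsymm]
  · rw [hmove' x y z hx hy hz hxy hzy, hsymm z y, hmove' y z w hy hz hw (Ne.symm hzy) hzw.symm,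
      hsymm]

section Kernel

variable {n : ℕ} {p : Fin n} {g : Sym2 (Fin n) → Sym2 (Fin n) → ℝ}

theorem switch_eq (hn : Even n) (hsymm : ∀ e e', g e e' = g e' e)
    (hp : ∀ e e', p ∈ e → g e e' = 0)
    (hg : ∀ x, IsMatchingVector univ x → edgeForm g x x = 0)
    {b c d x y z w : Fin n} (hnd : [p, b, c, d, x, y, z, w].Nodup) :
    g s(c, d) s(x, y) + g s(c, d) s(z, w) - g s(c, d) s(x, z) - g s(c, d) s(y, w) =
      g s(b, d) s(x, y) + g s(b, d) s(z, w) - g s(b, d) s(x, z) - g s(b, d) s(y, w) := by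
  have hcard : #(univ \ [p, b, c, d, x, y, z, w].toFinset) = n - 8 := by
    rw [card_univ_sdiff, Fintype.card_fin, List.toFinset_card_of_nodup hnd]; rfl
  obtain ⟨N, hN⟩ := IsMatchingVector.exists_of_even (univ \ [p, b, c, d, x, y, z, w].toFinset)
    (by rw [hcard]; exact hn.tsub (by decide))
  have hp' : ∀ e e', p ∈ e' → g e e' = 0 := fun e e' h => by rw [hsymm, hp _ _ h]
  have key : ∀ a₁ a₂ a₃ a₄ b₁ b₂ b₃ b₄ : Fin n,
      [a₁, a₂, a₃, a₄, b₁, b₂, b₃, b₄].Perm [p, b, c, d, x, y, z, w] →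
      edgeForm g (N + Pi.single s(a₁, a₂) 1 + Pi.single s(a₃, a₄) 1 + Pi.single s(b₁, b₂) 1 +
        Pi.single s(b₃, b₄) 1) (N + Pi.single s(a₁, a₂) 1 + Pi.single s(a₃, a₄) 1 +
        Pi.single s(b₁, b₂) 1 + Pi.single s(b₃, b₄) 1) = 0 := by
    intro a₁ a₂ a₃ a₄ b₁ b₂ b₃ b₄ hperm
    have hnd' := hperm.nodup_iff.2 hnd
    rw [← List.toFinset_eq_of_perm _ _ hperm] at hN
    have h := (((hN.cons_sdiff hnd').cons_sdiff hnd'.of_cons.of_cons).cons_sdiff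
      hnd'.of_cons.of_cons.of_cons.of_cons).cons_sdiff
      hnd'.of_cons.of_cons.of_cons.of_cons.of_cons.of_cons
    rw [List.toFinset_nil, sdiff_empty] at h
    exact hg _ h
  have hyz (l : List (Fin n)) : (l ++ [x, z, y, w]).Perm (l ++ [x, y, z, w]) :=
    ((List.Perm.swap y z [w]).cons x).append_left l
  have hbc (l : List (Fin n)) : (p :: c :: b :: l).Perm (p :: b :: c :: l) :=
    (List.Perm.swap b c l).cons p
  have h₁ := key p b c d x y z w (List.Perm.refl _)
  have h₂ := key p b c d x z y w (hyz [p, b, c, d])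
  have h₃ := key p c b d x y z w (hbc _)
  have h₄ := key p c b d x z y w ((hyz [p, c, b, d]).trans (hbc _))
  simp only [map_add, LinearMap.add_apply, edgeForm_single, hp _ _ (Sym2.mem_mk_left p _),
    hp' _ _ (Sym2.mem_mk_left p _)] at h₁ h₂ h₃ h₄
  rw [hsymm s(x, y) s(c, d), hsymm s(z, w) s(c, d), hsymm s(x, y) s(z, w)] at h₁
  rw [hsymm s(x, z) s(c, d), hsymm s(y, w) s(c, d), hsymm s(x, z) s(y, w)] at h₂
  rw [hsymm s(x, y) s(b, d), hsymm s(z, w) s(b, d), hsymm s(x, y) s(z, w)] at h₃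
  rw [hsymm s(x, z) s(b, d), hsymm s(y, w) s(b, d), hsymm s(x, z) s(y, w)] at h₄
  linear_combination (h₁ - h₂ - h₃ + h₄) / 2

/-- The mixed second difference of `g`, moving an endpoint of the first edge from `b` to `c` and
an endpoint of the second edge from `z` to `x`, while the other endpoints `d` and `y` are fixed. -/
def mixedDiff (g : Sym2 (Fin n) → Sym2 (Fin n) → ℝ) (c b x z d y : Fin n) : ℝ :=
  g s(c, d) s(x, y) - g s(b, d) s(x, y) - g s(c, d) s(z, y) + g s(b, d) s(z, y)

theorem mixedDiff_swap (hsymm : ∀ e e', g e e' = g e' e) (c b x z d y : Fin n) :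
    mixedDiff g c b x z d y = mixedDiff g x z c b y d := by
  simp only [mixedDiff]
  rw [hsymm s(x, y), hsymm s(x, y), hsymm s(z, y), hsymm s(z, y)]
  ring

/-- The relations obtained in `switch_eq`. -/
def SwitchInvariant (p : Fin n) (g : Sym2 (Fin n) → Sym2 (Fin n) → ℝ) : Prop :=
  ∀ b c d x y z w : Fin n, [p, b, c, d, x, y, z, w].Nodup →
    g s(c, d) s(x, y) + g s(c, d) s(z, w) - g s(c, d) s(x, z) - g s(c, d) s(y, w) =
      g s(b, d) s(x, y) + g s(b, d) s(z, w) - g s(b, d) s(x, z) - g s(b, d) s(y, w)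

namespace SwitchInvariant

theorem mixedDiff_eq_right (h : SwitchInvariant p g) {c b x z d y w : Fin n}
    (hnd : [p, c, b, x, z, d, y].Nodup) (hw : w ∉ [p, c, b, x, z, d]) :
    mixedDiff g c b x z d y = mixedDiff g c b x z d w := by
  by_cases hyw : y = w
  · rw [hyw]
  · have := h b c d x y w z (by simp at hnd hw ⊢; grind)
    simp only [mixedDiff]
    rw [Sym2.eq_swap (a := w) (b := z), Sym2.eq_swap (a := y) (b := z)] at this
    linear_combination this

theorem mixedDiff_eq_left (hsymm : ∀ e e', g e e' = g e' e) (h : SwitchInvariant p g)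
    {c b x z d y w : Fin n}
    (hnd : [p, c, b, x, z, d, y].Nodup) (hw : w ∉ [p, c, b, x, z, y]) :
    mixedDiff g c b x z d y = mixedDiff g c b x z w y := by
  rw [mixedDiff_swap hsymm, h.mixedDiff_eq_right (w := w) (by simp at hnd ⊢; grind)
    (by simp at hw ⊢; grind), mixedDiff_swap hsymm]

theorem mixedDiff_eq (hn : 8 ≤ n) (hsymm : ∀ e e', g e e' = g e' e) (h : SwitchInvariant p g)
    {c b x z d y d' y' : Fin n}
    (hnd : [p, c, b, x, z, d, y].Nodup) (hnd' : [p, c, b, x, z, d', y'].Nodup) :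
    mixedDiff g c b x z d y = mixedDiff g c b x z d' y' := by
  by_cases h₁ : d' = y
  · subst h₁
    by_cases h₂ : y' = d
    · subst h₂
      obtain ⟨e, he⟩ := exists_notMem_of_length_lt [p, c, b, x, z, y', d'] (by simp; omega)
      rw [h.mixedDiff_eq_right (w := e) hnd (by simp at he ⊢; grind),
        h.mixedDiff_eq_left hsymm (w := d') (by simp at he hnd ⊢; grind)
          (by simp at he hnd ⊢; grind),
        h.mixedDiff_eq_right (w := y') (by simp at he hnd ⊢; grind) (by simp at hnd ⊢; grind)]
    · rw [h.mixedDiff_eq_right (w := y') hnd (by simp at hnd hnd' ⊢; grind),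
        h.mixedDiff_eq_left hsymm (w := d') (by simp at hnd hnd' ⊢; grind)
          (by simp at hnd hnd' ⊢; grind)]
  · rw [h.mixedDiff_eq_left hsymm (w := d') hnd (by simp at hnd hnd' ⊢; grind),
      h.mixedDiff_eq_right (w := y') (by simp at hnd hnd' ⊢; grind)
        (by simp at hnd hnd' ⊢; grind)]

/-- The cyclic relation between the mixed differences on four points. -/
theorem mixedDiff_cyclic (hn : 8 ≤ n) (hsymm : ∀ e e', g e e' = g e' e) (h : SwitchInvariant p g)
    {c b x z d y : Fin n} (hnd : [p, c, b, x, z, d, y].Nodup) :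
    mixedDiff g c b x z d y + mixedDiff g b x c z d y + mixedDiff g x c b z d y = 0 := by
  have h₁ := h.mixedDiff_eq hn hsymm (d' := y) (y' := d) hnd (by simp at hnd ⊢; grind)
  have h₂ := h.mixedDiff_eq hn hsymm (c := b) (b := x) (x := c) (z := z) (d := d) (y := y)
    (d' := y) (y' := d) (by simp at hnd ⊢; grind) (by simp at hnd ⊢; grind)
  have h₃ := h.mixedDiff_eq hn hsymm (c := x) (b := c) (x := b) (z := z) (d := d) (y := y)
    (d' := y) (y' := d) (by simp at hnd ⊢; grind) (by simp at hnd ⊢; grind)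
  simp only [mixedDiff] at h₁ h₂ h₃ ⊢
  rw [hsymm s(c, y) s(x, d), hsymm s(b, y) s(x, d)] at h₁
  rw [hsymm s(b, y) s(c, d), hsymm s(x, y) s(c, d)] at h₂
  rw [hsymm s(x, y) s(b, d), hsymm s(c, y) s(b, d)] at h₃
  linarith

/-- All mixed differences vanish as soon as enough of them do. -/
theorem mixedDiff_eq_zero {q r s : Fin n} (hn : 8 ≤ n)
    (hsymm : ∀ e e', g e e' = g e' e)
    (h : SwitchInvariant p g) (hpqrs : [p, q, r, s].Nodup)
    (h₁ : ∀ x, x ∉ [p, q, r, s] → ∃ d y, [p, x, s, r, q, d, y].Nodup ∧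
      mixedDiff g x s r q d y = 0)
    (h₂ : ∀ x y, x ∉ [p, q, r] → y ∉ [p, q, r] → x < y →
      ∃ d w, [p, y, r, x, q, d, w].Nodup ∧ mixedDiff g y r x q d w = 0)
    {c b x z d y : Fin n} (hnd : [p, c, b, x, z, d, y].Nodup) :
    mixedDiff g c b x z d y = 0 := by
  -- two further points are always available outside the at most six points in use
  have htwo (l : List (Fin n)) (hl : l.length ≤ 6) : ∃ d y, d ∉ l ∧ y ∉ l ∧ d ≠ y := by
    obtain ⟨d, hd⟩ := exists_notMem_of_length_lt l (by omega)
    obtain ⟨y, hy⟩ := exists_notMem_of_length_lt (d :: l) (by simp; omega)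
    exact ⟨d, y, hd, by simp at hy; tauto, by simp at hy; tauto⟩
  have hsub (c e b x z d y : Fin n) :
      mixedDiff g c b x z d y = mixedDiff g c e x z d y - mixedDiff g b e x z d y := by
    simp only [mixedDiff]; ring
  have hneg (c b x z d y : Fin n) : mixedDiff g c b x z d y = -mixedDiff g b c x z d y := by
    simp only [mixedDiff]; ring
  have A₁ (x d y : Fin n) (hnd : [p, x, s, r, q, d, y].Nodup) : mixedDiff g x s r q d y = 0 := by
    obtain ⟨d', y', hnd', h0⟩ := h₁ x (by simp at hnd ⊢; grind)
    rw [h.mixedDiff_eq hn hsymm hnd hnd', h0]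
  have A (x y d w : Fin n) (hnd : [p, x, y, r, q, d, w].Nodup) :
      mixedDiff g x y r q d w = 0 := by
    by_cases hys : y = s
    · subst hys; exact A₁ x d w hnd
    by_cases hxs : x = s
    · subst hxs
      rw [hneg, A₁ y d w (by simp at hnd ⊢; grind), neg_zero]
    obtain ⟨d', w', hd, hw, hdw⟩ := htwo [p, x, y, r, q, s] (by simp)
    rw [h.mixedDiff_eq hn hsymm (d' := d') (y' := w') hnd (by simp at hnd hd hw ⊢; grind),
      hsub x s y, A₁ x d' w' (by simp at hpqrs hnd hd hw ⊢; grind),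
      A₁ y d' w' (by simp at hpqrs hnd hd hw ⊢; grind), sub_zero]
  have B₁ (x y d w : Fin n) (hnd : [p, y, r, x, q, d, w].Nodup) (hxy : x < y) :
      mixedDiff g y r x q d w = 0 := by
    obtain ⟨d', y', hnd', h0⟩ := h₂ x y (by simp at hnd ⊢; grind) (by simp at hnd ⊢; grind) hxy
    rw [h.mixedDiff_eq hn hsymm hnd hnd', h0]
  have B (x y d w : Fin n) (hnd : [p, y, r, x, q, d, w].Nodup) :
      mixedDiff g y r x q d w = 0 := by
    have hxy : x ≠ y := by simp at hnd; grind
    rcases hxy.lt_or_gt with hlt | hlt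
    · exact B₁ x y d w hnd hlt
    · have := h.mixedDiff_cyclic hn hsymm hnd
      rw [hneg r x, B₁ y x d w (by simp at hnd ⊢; grind) hlt,
        A x y d w (by simp at hnd ⊢; grind)] at this
      linarith
  have C (c b x d y : Fin n) (hnd : [p, c, b, x, q, d, y].Nodup) :
      mixedDiff g c b x q d y = 0 := by
    by_cases hx : x = r
    · subst hx; exact A c b d y hnd
    by_cases hb : b = r
    · subst hb; exact B x c d y hnd
    by_cases hc : c = r
    · subst hc
      rw [hneg, B x b d y (by simp at hnd ⊢; grind), neg_zero]
    obtain ⟨d', w', hd, hw, hdw⟩ := htwo [p, c, b, r, x, q] (by simp)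
    rw [h.mixedDiff_eq hn hsymm (d' := d') (y' := w') hnd (by simp at hnd hd hw ⊢; grind),
      hsub c r b, B x c d' w' (by simp at hpqrs hnd hd hw ⊢; grind),
      B x b d' w' (by simp at hpqrs hnd hd hw ⊢; grind), sub_zero]
  have D (c b x z d y : Fin n) (hnd : [p, c, b, x, z, d, y].Nodup) (hc : q ≠ c) (hb : q ≠ b) :
      mixedDiff g c b x z d y = 0 := by
    by_cases hz : z = q
    · subst hz; exact C c b x d y hnd
    by_cases hx : x = q
    · subst hx
      have := C c b z d y (by simp at hnd ⊢; grind)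
      simp only [mixedDiff] at this ⊢
      linarith
    obtain ⟨d', w', hd, hw, hdw⟩ := htwo [p, c, b, x, z, q] (by simp)
    rw [h.mixedDiff_eq hn hsymm (d' := d') (y' := w') hnd (by simp at hnd hd hw ⊢; grind)]
    have h₁ := C c b x d' w' (by simp at hpqrs hnd hd hw ⊢; grind)
    have h₂ := C c b z d' w' (by simp at hpqrs hnd hd hw ⊢; grind)
    simp only [mixedDiff] at h₁ h₂ ⊢
    linarith
  by_cases hq : q ≠ c ∧ q ≠ b
  · exact D c b x z d y hnd hq.1 hq.2
  · rw [mixedDiff_swap hsymm]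
    apply D <;> (simp at hnd ⊢; grind)

end SwitchInvariant

theorem eq_zero_of_mixedDiff_eq_zero (hn : Even n) (hn8 : 8 ≤ n) (hsymm : ∀ e e', g e e' = g e' e)
    (hp : ∀ e e', p ∈ e → g e e' = 0) (hself : ∀ e, g e e = 0)
    (hg : ∀ x, IsMatchingVector univ x → edgeForm g x x = 0)
    (hmixed : ∀ c b x z d y : Fin n, [p, c, b, x, z, d, y].Nodup → mixedDiff g c b x z d y = 0)
    {a b c d : Fin n} (hnd : [p, a, b, c, d].Nodup) : g s(a, b) s(c, d) = 0 := by
  have hform (v w : Sym2 (Fin n) → ℝ) : edgeForm g v w = edgeForm g w v := by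
    rw [edgeForm, Matrix.toBilin'_apply, Matrix.toBilin'_apply, Finset.sum_comm]
    exact sum_congr rfl fun e _ => sum_congr rfl fun e' _ => by
      simp only [Matrix.of_apply]; rw [hsymm e' e]; ring
  have hpform (v : Sym2 (Fin n) → ℝ) (u : Fin n) : edgeForm g v (Pi.single s(p, u) 1) = 0 := by
    rw [hform, edgeForm, Matrix.toBilin'_apply]
    refine sum_eq_zero fun e _ => sum_eq_zero fun e' _ => ?_
    by_cases he : e = s(p, u)
    · simp [he, hp]
    · simp [he]
  -- the form does not change when a vertex of the second edge is moved
  have hmove (a b c x y : Fin n) (hnd : [p, a, b, c, x, y].Nodup) :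
      g s(x, y) s(b, c) = g s(x, y) s(a, c) := by
    set S : Finset (Fin n) := univ \ [p, a, b, c].toFinset with hS
    have hnd4 : [p, a, b, c].Nodup := by simp at hnd ⊢; grind
    obtain ⟨M, hM⟩ := IsMatchingVector.exists_of_even S (by
      rw [hS, card_univ_sdiff, Fintype.card_fin, List.toFinset_card_of_nodup hnd4]
      exact hn.tsub ⟨2, rfl⟩)
    have h₁ := hg _ (by
      simpa using (hM.cons_sdiff hnd4).cons_sdiff hnd4.of_cons.of_cons)
    have hnd4' : [p, b, a, c].Nodup := by simp at hnd4 ⊢; grind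
    have hS' : S = univ \ [p, b, a, c].toFinset := by
      rw [hS, List.toFinset_eq_of_perm _ _ ((List.Perm.swap a b [c]).cons p).symm]
    have h₂ := hg _ (by
      simpa using ((hS' ▸ hM).cons_sdiff hnd4').cons_sdiff hnd4'.of_cons.of_cons)
    obtain ⟨j, hj, hj0⟩ := hM.exists_nat_mul
      (edgeForm g (Pi.single s(b, c) 1) - edgeForm g (Pi.single s(a, c) 1))
      (g s(x, y) s(b, c) - g s(x, y) s(a, c)) (by
        intro u v hu hv huv
        rw [LinearMap.sub_apply, edgeForm_single, edgeForm_single, hsymm, hsymm s(a, c)]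
        refine eq_of_eq_of_move (s := fun v => v ∉ [p, a, b, c])
          (φ := fun u v => g s(u, v) s(b, c) - g s(u, v) s(a, c)) (x := u) (y := v) (z := x)
          (w := y) ?_ ?_ ?_ ?_ ?_ ?_ huv ?_
        · intro u v; rw [Sym2.eq_swap]
        · intro u v w hu hv hw huv hwv huw
          have := hmixed u w b a v c (by simp at hu hv hw hnd ⊢; grind)
          simp only [mixedDiff] at this
          linarith
        · simpa [hS] using hu
        · simpa [hS] using hv
        · simp at hnd ⊢; grind
        · simp at hnd ⊢; grind
        · simp at hnd ⊢; grind)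
    rw [LinearMap.sub_apply, hform _ M, hform _ M] at hj
    simp only [map_add, LinearMap.add_apply, hform (Pi.single _ _) M, hpform, edgeForm_single,
      hself, hp _ _ (Sym2.mem_mk_left p _)] at h₁ h₂
    have hj' : (j : ℝ) ≠ 0 := by
      have := hj0 ⟨x, by simp [hS] at hnd ⊢; grind⟩
      positivity
    have : (j : ℝ) * (g s(x, y) s(b, c) - g s(x, y) s(a, c)) = 0 := by linarith
    rcases mul_eq_zero.1 this with h | h
    · contradiction
    · linarith
  -- hence it is constant on pairs of disjoint edges avoiding `p`
  have hright (x y b c b' c' : Fin n) (h : [p, x, y, b, c].Nodup) (h' : [p, x, y, b', c'].Nodup) :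
      g s(x, y) s(b, c) = g s(x, y) s(b', c') := by
    refine eq_of_eq_of_move (s := fun v => v ∉ [p, x, y]) (φ := fun b c => g s(x, y) s(b, c))
      (x := b) (y := c) (z := b') (w := c') ?_ ?_ ?_ ?_ ?_ ?_ ?_ ?_
    · exact fun u v => congrArg _ Sym2.eq_swap
    · intro u v w hu hv hw huv hwv huw
      exact hmove w u v x y (by simp at hu hv hw h ⊢; grind)
    all_goals simp at h h' ⊢; grind
  have hconst (a' b' c' d' : Fin n) (h : [p, a', b', c', d'].Nodup) :
      g s(a', b') s(c', d') = g s(a, b) s(c, d) := by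
    obtain ⟨u, hu⟩ := exists_notMem_of_length_lt [p, a, b, a', b'] (by simp; omega)
    obtain ⟨v, hv⟩ := exists_notMem_of_length_lt [p, a, b, a', b', u] (by simp; omega)
    rw [hright a' b' c' d' u v h (by simp at h hu hv ⊢; grind), hsymm,
      hright u v a' b' a b (by simp at h hu hv ⊢; grind) (by simp at hnd hu hv ⊢; grind), hsymm,
      hright a b c d u v hnd (by simp at hnd hu hv ⊢; grind)]
  set C := g s(a, b) s(c, d) with hC
  have hmul (S : Finset (Fin n)) (x : Sym2 (Fin n) → ℝ) (hx : IsMatchingVector S x) (hpS : p ∉ S) :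
      ∃ N : ℕ, edgeForm g x x = N * C ∧ (2 < #S → 0 < N) := by
    induction hx with
    | nil => exact ⟨0, by simp⟩
    | @cons S x u v huv hu hv hx ih =>
      simp only [mem_insert, not_or] at hpS
      obtain ⟨N, hN, -⟩ := ih hpS.2.2
      obtain ⟨j, hj, hj0⟩ := hx.exists_nat_mul (edgeForm g (Pi.single s(u, v) 1)) C (by
        intro u' v' hu' hv' huv'
        rw [edgeForm_single]
        refine hconst _ _ _ _ ?_
        have := ne_of_mem_of_not_mem hu' hu
        have := ne_of_mem_of_not_mem hu' hv
        have := ne_of_mem_of_not_mem hv' hu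
        have := ne_of_mem_of_not_mem hv' hv
        have := ne_of_mem_of_not_mem hu' hpS.2.2
        have := ne_of_mem_of_not_mem hv' hpS.2.2
        simp; grind)
      refine ⟨N + 2 * j, ?_, fun h => ?_⟩
      · simp only [map_add, LinearMap.add_apply, hform x (Pi.single _ _), hj, hN,
          edgeForm_single, hself]
        push_cast; ring
      · rw [card_insert_of_notMem (by simp [hu, huv]), card_insert_of_notMem hv] at h
        have := hj0 (card_pos.1 (by omega))
        omega
  have hpa : [p, a].Nodup := by simp at hnd ⊢; grind
  have hcard : #(univ \ [p, a].toFinset) = n - 2 := by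
    rw [card_univ_sdiff, Fintype.card_fin, List.toFinset_card_of_nodup hpa]; rfl
  obtain ⟨M, hM⟩ := IsMatchingVector.exists_of_even (univ \ [p, a].toFinset)
    (by rw [hcard]; exact hn.tsub (by decide))
  obtain ⟨N, hN, hN0⟩ := hmul _ _ hM (by simp)
  have h := hg _ (by simpa using hM.cons_sdiff hpa)
  simp only [map_add, LinearMap.add_apply, hform (Pi.single _ _) M, hpform, hN,
    add_zero] at h
  have : (N : ℝ) ≠ 0 := by
    have := hN0 (by omega)
    positivity
  exact (mul_eq_zero.1 h).resolve_left this

end Kernel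

/-- The graph whose vertices are the edges of the complete graph on `Fin n`, in which two edges
avoiding the vertex `p` are adjacent if they are disjoint. -/
def disjointEdgeGraph {n : ℕ} (p : Fin n) : SimpleGraph (Sym2 (Fin n)) where
  Adj e e' := ¬ e.IsDiag ∧ ¬ e'.IsDiag ∧ p ∉ e ∧ p ∉ e' ∧ ∀ v, ¬ (v ∈ e ∧ v ∈ e')
  symm := ⟨fun _ _ h => ⟨h.2.1, h.1, h.2.2.2.1, h.2.2.1, fun v hv => h.2.2.2.2 v hv.symm⟩⟩
  loopless := ⟨fun e h => h.2.2.2.2 _ ⟨e.out_fst_mem, e.out_fst_mem⟩⟩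

theorem disjointEdgeGraph_adj {n : ℕ} {p : Fin n} {e e' : Sym2 (Fin n)} :
    (disjointEdgeGraph p).Adj e e' ↔
      ¬ e.IsDiag ∧ ¬ e'.IsDiag ∧ p ∉ e ∧ p ∉ e' ∧ ∀ v, ¬ (v ∈ e ∧ v ∈ e') := Iff.rfl

theorem disjointEdgeGraph_adj_mk {n : ℕ} {p a b c d : Fin n} :
    (disjointEdgeGraph p).Adj s(a, b) s(c, d) ↔ [p, a, b, c, d].Nodup := by
  rw [disjointEdgeGraph_adj]
  simp
  grind

instance {n : ℕ} (p : Fin n) : DecidableRel (disjointEdgeGraph p).Adj := fun _ _ =>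
  decidable_of_iff' _ disjointEdgeGraph_adj

/-- The symmetric matrix supported on the edges of `G` given by a function on these edges. -/
def edgeMatrix {V : Type*} (G : SimpleGraph V) [DecidableRel G.Adj] :
    (G.edgeSet → ℝ) →ₗ[ℝ] (V → V → ℝ) where
  toFun f e e' := if h : G.Adj e e' then f ⟨s(e, e'), G.mem_edgeSet.2 h⟩ else 0
  map_add' f f' := by
    ext e e'
    simp only [Pi.add_apply]
    split_ifs <;> simp
  map_smul' c f := by
    ext e e'
    simp only [Pi.smul_apply]
    split_ifs <;> simp

section edgeMatrix

variable {V : Type*} {G : SimpleGraph V} [DecidableRel G.Adj] (f : G.edgeSet → ℝ)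

theorem edgeMatrix_of_adj {e e' : V} (h : G.Adj e e') :
    edgeMatrix G f e e' = f ⟨s(e, e'), G.mem_edgeSet.2 h⟩ := by
  simp [edgeMatrix, h]

theorem edgeMatrix_of_not_adj {e e' : V} (h : ¬ G.Adj e e') : edgeMatrix G f e e' = 0 := by
  simp [edgeMatrix, h]

theorem edgeMatrix_symm (e e' : V) : edgeMatrix G f e e' = edgeMatrix G f e' e := by
  by_cases h : G.Adj e e'
  · rw [edgeMatrix_of_adj f h, edgeMatrix_of_adj f h.symm]
    congr 2
    exact Sym2.eq_swap
  · rw [edgeMatrix_of_not_adj f h, edgeMatrix_of_not_adj f fun h' => h h'.symm]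

end edgeMatrix

/-- The function on perfect matchings summing the entries of a matrix over the pairs of edges of
a perfect matching. -/
def matchingSum (n : ℕ) : (Sym2 (Fin n) → Sym2 (Fin n) → ℝ) →ₗ[ℝ] (PM n → ℝ) where
  toFun g P := ∑ e ∈ P.1, ∑ e' ∈ P.1, g e e'
  map_add' g g' := by ext P; simp [sum_add_distrib]
  map_smul' c g := by ext P; simp [mul_sum]

/-- The linear map whose range is the span of the vectors attached to pairs of disjoint edges. -/
def pairSum {n : ℕ} (p : Fin n) : ((disjointEdgeGraph p).edgeSet → ℝ) →ₗ[ℝ] (PM n → ℝ) :=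
  matchingSum n ∘ₗ edgeMatrix (disjointEdgeGraph p)

/-- The edges avoiding `p` and `q` and different from `s(r, s)`, which index a basis of the
kernel of `pairSum p`. -/
abbrev KernelIndex {n : ℕ} (p q r s : Fin n) :=
  {z : Sym2 (Fin n) // ¬ z.IsDiag ∧ p ∉ z ∧ q ∉ z ∧ z ≠ s(r, s)}

/-- `mixedDiff` as a linear form. -/
def mixedDiffForm {n : ℕ} (c b x z d y : Fin n) :
    (Sym2 (Fin n) → Sym2 (Fin n) → ℝ) →ₗ[ℝ] ℝ where
  toFun g := mixedDiff g c b x z d y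
  map_add' g g' := by simp only [mixedDiff, Pi.add_apply]; ring
  map_smul' c g := by simp only [mixedDiff, Pi.smul_apply, smul_eq_mul, RingHom.id_apply]; ring

theorem exists_kernelForm {n : ℕ} {p q r s : Fin n} (hn : 8 ≤ n) (hpqrs : [p, q, r, s].Nodup)
    (z : KernelIndex p q r s) :
    ∃ φ : (Sym2 (Fin n) → Sym2 (Fin n) → ℝ) →ₗ[ℝ] ℝ,
      (∀ x, z.1 = s(r, x) → ∃ d y, [p, x, s, r, q, d, y].Nodup ∧
        φ = mixedDiffForm x s r q d y) ∧
      (∀ x y, z.1 = s(x, y) → x < y → x ≠ r → y ≠ r → ∃ d w, [p, y, r, x, q, d, w].Nodup ∧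
        φ = mixedDiffForm y r x q d w) := by
  obtain ⟨z, hz, hp, hq, hrs⟩ := z
  by_cases hr : r ∈ z
  · obtain ⟨x, rfl⟩ := hr
    obtain ⟨d, hd⟩ := exists_notMem_of_length_lt [p, x, s, r, q] (by simp; omega)
    obtain ⟨y, hy⟩ := exists_notMem_of_length_lt [p, x, s, r, q, d] (by simp; omega)
    refine ⟨mixedDiffForm x s r q d y, fun x' hx' => ?_, fun u v huv _ hu hv => ?_⟩
    · obtain rfl : x = x' := Sym2.congr_right.1 hx'
      refine ⟨d, y, ?_, rfl⟩
      simp at hpqrs hz hp hq hrs hd hy ⊢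
      grind
    · have : r ∈ s(u, v) := huv ▸ Sym2.mem_mk_left r x
      rcases Sym2.mem_iff.1 this with rfl | rfl <;> contradiction
  · obtain ⟨d, hd⟩ := exists_notMem_of_length_lt [p, z.inf, z.sup, r, q] (by simp; omega)
    obtain ⟨w, hw⟩ := exists_notMem_of_length_lt [p, z.inf, z.sup, r, q, d] (by simp; omega)
    refine ⟨mixedDiffForm z.sup r z.inf q d w, fun x hx => ?_, fun u v huv hlt hu hv => ?_⟩
    · exact absurd ((show z = s(r, x) from hx) ▸ Sym2.mem_mk_left r x) hr
    · have h₁ : z.inf = u := by simp only at huv; simp [huv, hlt.le]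
      have h₂ : z.sup = v := by simp only at huv; simp [huv, hlt.le]
      rw [h₁, h₂] at hd hw ⊢
      simp only at huv
      subst huv
      refine ⟨d, w, ?_, rfl⟩
      simp at hpqrs hz hp hq hd hw ⊢
      grind

theorem finrank_ker_pairSum_le {n : ℕ} {p q r s : Fin n} (hn : Even n) (hn8 : 8 ≤ n)
    (hpqrs : [p, q, r, s].Nodup) :
    Module.finrank ℝ (LinearMap.ker (pairSum p)) ≤ Fintype.card (KernelIndex p q r s) := by
  choose φ hφ using exists_kernelForm hn8 hpqrs
  rw [← Module.finrank_fintype_fun_eq_card ℝ]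
  refine LinearMap.finrank_le_finrank_of_injective
    (f := LinearMap.pi φ ∘ₗ edgeMatrix (disjointEdgeGraph p) ∘ₗ
      (LinearMap.ker (pairSum p)).subtype) ?_
  rw [← LinearMap.ker_eq_bot, LinearMap.ker_eq_bot']
  rintro ⟨f, hf⟩ hφf
  set g := edgeMatrix (disjointEdgeGraph p) f
  have hφg (z) : φ z g = 0 := congrFun hφf z
  have hg (P : PM n) : ∑ e ∈ P.1, ∑ e' ∈ P.1, g e e' = 0 := congrFun hf P
  have hg' (x) (hx : IsMatchingVector univ x) : edgeForm g x x = 0 := hx.edgeForm_self_eq_zero hg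
  have hsymm := edgeMatrix_symm (G := disjointEdgeGraph p) f
  have hp (e e') (h : p ∈ e) : g e e' = 0 := edgeMatrix_of_not_adj f fun h' => h'.2.2.1 h
  have hself (e) : g e e = 0 := edgeMatrix_of_not_adj f (SimpleGraph.irrefl _)
  have hswitch : SwitchInvariant p g := fun _ _ _ _ _ _ _ => switch_eq hn hsymm hp hg'
  have hmixed (c b x z d y : Fin n) (hnd : [p, c, b, x, z, d, y].Nodup) :
      mixedDiff g c b x z d y = 0 := by
    refine hswitch.mixedDiff_eq_zero hn8 hsymm hpqrs ?_ ?_ hnd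
    · intro x hx
      have hz : ¬ s(r, x).IsDiag ∧ p ∉ s(r, x) ∧ q ∉ s(r, x) ∧ s(r, x) ≠ s(r, s) := by
        simp at hx hpqrs ⊢; grind
      obtain ⟨d, y, hdy, h⟩ := (hφ ⟨s(r, x), hz⟩).1 x rfl
      exact ⟨d, y, hdy, by rw [← hφg ⟨s(r, x), hz⟩, h]; rfl⟩
    · intro x y hx hy hxy
      have hz : ¬ s(x, y).IsDiag ∧ p ∉ s(x, y) ∧ q ∉ s(x, y) ∧ s(x, y) ≠ s(r, s) := by
        simp at hx hy hpqrs ⊢; grind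
      obtain ⟨d, w, hdw, h⟩ := (hφ ⟨s(x, y), hz⟩).2 x y rfl hxy (by simp at hx; tauto)
        (by simp at hy; tauto)
      exact ⟨d, w, hdw, by rw [← hφg ⟨s(x, y), hz⟩, h]; rfl⟩
  ext ⟨E, hE⟩
  induction E with | _ e e'
  have hE' : (disjointEdgeGraph p).Adj e e' := hE
  induction e with | _ a b
  induction e' with | _ c d
  have := eq_zero_of_mixedDiff_eq_zero hn hn8 hsymm hp hself hg' hmixed
    (disjointEdgeGraph_adj_mk.1 hE')
  rwa [edgeMatrix_of_adj f hE'] at this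

theorem card_edges_avoiding {n : ℕ} (S : Finset (Fin n)) :
    #{z : Sym2 (Fin n) | ¬ z.IsDiag ∧ ∀ v ∈ S, v ∉ z} = (n - #S).choose 2 := by
  have hcard : #(univ \ S) = n - #S := by rw [card_univ_sdiff, Fintype.card_fin]
  rw [← hcard, ← Sym2.card_image_offDiag]
  congr 1
  ext z
  induction z with | _ a b
  simp only [mem_filter, mem_univ, true_and, mem_image, mem_offDiag, mem_sdiff, Prod.exists,
    Sym2.mk_isDiag_iff, Sym2.mem_iff, not_or]
  constructor
  · rintro ⟨hab, h⟩
    exact ⟨a, b, ⟨fun ha => (h a ha).1 rfl, fun hb => (h b hb).2 rfl, hab⟩, rfl⟩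
  · rintro ⟨c, d, ⟨hc, hd, hcd⟩, h⟩
    rcases Sym2.eq_iff.1 h with ⟨rfl, rfl⟩ | ⟨rfl, rfl⟩
    · exact ⟨hcd, fun v hv => ⟨ne_of_mem_of_not_mem hv hc, ne_of_mem_of_not_mem hv hd⟩⟩
    · exact ⟨hcd.symm, fun v hv => ⟨ne_of_mem_of_not_mem hv hd, ne_of_mem_of_not_mem hv hc⟩⟩

theorem card_kernelIndex {n : ℕ} {p q r s : Fin n} (h : [p, q, r, s].Nodup) :
    Fintype.card (KernelIndex p q r s) = (n - 2).choose 2 - 1 := by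
  have hpq : #({p, q} : Finset (Fin n)) = 2 := card_pair (by simp at h; grind)
  have hcard := card_edges_avoiding {p, q}
  rw [hpq] at hcard
  rw [Fintype.card_subtype, ← hcard, ← card_erase_of_mem (a := s(r, s))]
  · congr 1
    ext z
    simp
    tauto
  · simp at h ⊢
    grind

theorem two_mul_card_edgeSet {n : ℕ} (p : Fin n) :
    2 * Fintype.card (disjointEdgeGraph p).edgeSet = (n - 1).choose 2 * (n - 3).choose 2 := by
  have hdeg (e : Sym2 (Fin n)) (he : ¬ e.IsDiag ∧ p ∉ e) :
      (disjointEdgeGraph p).degree e = (n - 3).choose 2 := by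
    have hcard : #(insert p e.toFinset) = 3 := by
      rw [card_insert_of_notMem (by simp [he.2]), Sym2.card_toFinset_of_not_isDiag e he.1]
    rw [← SimpleGraph.card_neighborFinset_eq_degree, ← hcard, ← card_edges_avoiding]
    congr 1
    ext z
    simp only [SimpleGraph.mem_neighborFinset, disjointEdgeGraph_adj, mem_filter, mem_univ,
      true_and, mem_insert, forall_eq_or_imp, Sym2.mem_toFinset]
    have := he.1
    have := he.2
    grind
  have hdeg0 (e : Sym2 (Fin n)) (he : ¬ (¬ e.IsDiag ∧ p ∉ e)) :
      (disjointEdgeGraph p).degree e = 0 := by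
    rw [← SimpleGraph.card_neighborFinset_eq_degree, card_eq_zero, eq_empty_iff_forall_notMem]
    intro z hz
    rw [SimpleGraph.mem_neighborFinset] at hz
    exact he ⟨hz.1, hz.2.2.1⟩
  rw [← SimpleGraph.edgeFinset_card, ← SimpleGraph.sum_degrees_eq_twice_card_edges,
    ← sum_filter_of_ne (p := fun e => ¬ e.IsDiag ∧ p ∉ e) fun e _ he => by
      by_contra h; exact he (hdeg0 e h),
    sum_congr rfl fun e he => hdeg e (mem_filter.1 he).2, sum_const, smul_eq_mul]
  congr 1
  have := card_edges_avoiding {p}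
  simpa using this

/-- The indicator vector of the perfect matchings containing two given edges. -/
def pairIndicator {n : ℕ} (e₁ e₂ : Sym2 (Fin n)) (P : PM n) : ℝ :=
  if e₁ ∈ P.1 ∧ e₂ ∈ P.1 then 1 else 0

section pairIndicator

variable {n : ℕ}

theorem pairIndicator_comm (e₁ e₂ : Sym2 (Fin n)) : pairIndicator e₁ e₂ = pairIndicator e₂ e₁ := by
  ext P
  simp only [pairIndicator, and_comm]

theorem pairIndicator_eq_zero_of_mem {e : Sym2 (Fin n)} {a u : Fin n} (ha : a ∉ e) (hu : u ∈ e) :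
    pairIndicator e s(a, u) = 0 := by
  ext P
  simp only [pairIndicator, Pi.zero_apply, ite_eq_right_iff, one_ne_zero, imp_false, not_and]
  intro he hau
  have := (P.2.2 u).unique ⟨he, hu⟩ ⟨hau, Sym2.mem_mk_right a u⟩
  exact ha (this ▸ Sym2.mem_mk_left a u)

theorem pairIndicator_eq_zero_of_isDiag (e : Sym2 (Fin n)) (a : Fin n) :
    pairIndicator e s(a, a) = 0 := by
  ext P
  simp only [pairIndicator, Pi.zero_apply, ite_eq_right_iff, one_ne_zero, imp_false, not_and]
  exact fun _ h => P.2.1 _ h rfl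

theorem sum_pairIndicator (e : Sym2 (Fin n)) (a : Fin n) :
    ∑ u, pairIndicator e s(a, u) = pairIndicator e e := by
  ext P
  obtain ⟨z, ⟨hz, ha⟩, huniq⟩ := P.2.2 a
  obtain ⟨b, rfl⟩ := ha
  rw [Finset.sum_apply, sum_eq_single b]
  · simp [pairIndicator, hz]
  · intro u _ hu
    simp only [pairIndicator, ite_eq_right_iff, one_ne_zero, imp_false, not_and]
    intro _ h
    exact hu (Sym2.congr_right.1 (huniq _ ⟨h, Sym2.mem_mk_left a u⟩))
  · simp

theorem pairSum_single {p : Fin n} {e e' : Sym2 (Fin n)} (h : (disjointEdgeGraph p).Adj e e') :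
    pairSum p (Pi.single ⟨s(e, e'), (SimpleGraph.mem_edgeSet _).2 h⟩ 1) =
      (2 : ℝ) • pairIndicator e e' := by
  have key (x y : Sym2 (Fin n)) : edgeMatrix (disjointEdgeGraph p)
      (Pi.single ⟨s(e, e'), (SimpleGraph.mem_edgeSet _).2 h⟩ 1) x y =
      (if x = e then if y = e' then 1 else 0 else 0) +
      (if x = e' then if y = e then 1 else 0 else 0) := by
    have hne := h.ne
    by_cases hxy : (disjointEdgeGraph p).Adj x y
    · rw [edgeMatrix_of_adj _ hxy, Pi.single_apply]
      simp only [Subtype.mk.injEq, Sym2.eq_iff]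
      grind
    · rw [edgeMatrix_of_not_adj _ hxy]
      have : ¬ (x = e ∧ y = e') := by rintro ⟨rfl, rfl⟩; exact hxy h
      have : ¬ (x = e' ∧ y = e) := by rintro ⟨rfl, rfl⟩; exact hxy h.symm
      grind
  ext P
  change ∑ x ∈ P.1, ∑ y ∈ P.1, _ = _
  simp only [key, sum_add_distrib, sum_ite_eq', sum_ite_irrel, sum_const_zero, Pi.smul_apply,
    smul_eq_mul, pairIndicator]
  by_cases h₁ : e ∈ P.1 <;> by_cases h₂ : e' ∈ P.1 <;> simp [h₁, h₂]
  norm_num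

theorem pairIndicator_mem_range {p : Fin n} {e e' : Sym2 (Fin n)}
    (h : (disjointEdgeGraph p).Adj e e') :
    pairIndicator e e' ∈ LinearMap.range (pairSum p) := by
  have := (LinearMap.range (pairSum p)).smul_mem (2 : ℝ)⁻¹
    (LinearMap.mem_range_self (pairSum p) (Pi.single ⟨s(e, e'), (SimpleGraph.mem_edgeSet _).2 h⟩ 1))
  rwa [pairSum_single h, smul_smul, inv_mul_cancel₀ two_ne_zero, one_smul] at this

theorem pairIndicator_mem_range_of_notMem (hn : 5 ≤ n) {p a : Fin n} {e : Sym2 (Fin n)}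
    (he : ¬ e.IsDiag) (hp : p ∉ e) (ha : a ∉ e) (hap : a ≠ p) :
    pairIndicator e s(p, a) ∈ LinearMap.range (pairSum p) := by
  set W := LinearMap.range (pairSum p)
  set S : Finset (Fin n) := univ \ insert p e.toFinset with hS
  have hmemS (u : Fin n) : u ∈ S ↔ u ≠ p ∧ u ∉ e := by simp [hS]
  have hcard : #S = n - 3 := by
    rw [hS, card_univ_sdiff, Fintype.card_fin, card_insert_of_notMem (by simp [hp]),
      Sym2.card_toFinset_of_not_isDiag e he]
  have hsum (a : Fin n) (ha : a ∉ e) : pairIndicator e e =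
      pairIndicator e s(a, p) + ∑ u ∈ S, pairIndicator e s(a, u) := by
    have hpS : p ∉ S := by simp [hS]
    rw [← sum_pairIndicator e a, ← sum_insert (f := fun u => pairIndicator e s(a, u)) hpS]
    refine (sum_subset (subset_univ _) fun u _ hu => ?_).symm
    rw [mem_insert, hmemS] at hu
    exact pairIndicator_eq_zero_of_mem ha (by tauto)
  have hmem (u v : Fin n) (hu : u ∈ S) (hv : v ∈ S) : pairIndicator e s(u, v) ∈ W := by
    by_cases huv : u = v
    · rw [huv, pairIndicator_eq_zero_of_isDiag]
      exact W.zero_mem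
    · rw [hmemS] at hu hv
      refine pairIndicator_mem_range ⟨he, by simpa using huv, hp, by simp; tauto, ?_⟩
      rintro w ⟨hw, hw'⟩
      rcases Sym2.mem_iff.1 hw' with rfl | rfl
      · exact hu.2 hw
      · exact hv.2 hw
  have hcontains : pairIndicator e e ∈ W := by
    have h₁ : ∑ u ∈ S, pairIndicator e e = ∑ u ∈ S, pairIndicator e s(p, u) +
        ∑ u ∈ S, ∑ v ∈ S, pairIndicator e s(u, v) := by
      rw [← sum_add_distrib]
      refine sum_congr rfl fun u hu => ?_
      rw [hsum u ((hmemS u).1 hu).2, Sym2.eq_swap]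
    have h₂ := hsum p hp
    rw [pairIndicator_eq_zero_of_isDiag, zero_add] at h₂
    rw [← h₂, sum_const, hcard, ← Nat.cast_smul_eq_nsmul ℝ] at h₁
    have h₃ : ((n - 3 : ℕ) - 1 : ℝ) • pairIndicator e e =
        ∑ u ∈ S, ∑ v ∈ S, pairIndicator e s(u, v) := by
      rw [sub_smul, h₁, one_smul, add_sub_cancel_left]
    have h₄ : ((n - 3 : ℕ) - 1 : ℝ) ≠ 0 := by
      have : (2 : ℝ) ≤ (n - 3 : ℕ) := by exact_mod_cast (by omega : 2 ≤ n - 3)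
      linarith
    rw [← W.smul_mem_iff h₄, h₃]
    exact W.sum_mem fun u hu => W.sum_mem fun v hv => hmem u v hu hv
  rw [Sym2.eq_swap, ← add_sub_cancel_right (pairIndicator e s(a, p))
    (∑ u ∈ S, pairIndicator e s(a, u)), ← hsum a ha]
  exact W.sub_mem hcontains (W.sum_mem fun u hu => hmem a u ((hmemS a).2 ⟨hap, ha⟩) hu)

theorem range_pairSum (hn : 5 ≤ n) (p : Fin n) :
    LinearMap.range (pairSum p) = Submodule.span ℝ {ν : PM n → ℝ | ∃ e₁ e₂ : Sym2 (Fin n),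
      ¬ e₁.IsDiag ∧ ¬ e₂.IsDiag ∧ (∀ v : Fin n, ¬ (v ∈ e₁ ∧ v ∈ e₂)) ∧
      ν = pairIndicator e₁ e₂} := by
  refine le_antisymm ?_ (Submodule.span_le.2 ?_)
  · rintro _ ⟨f, rfl⟩
    have : pairSum p f =
        ∑ e, ∑ e', edgeMatrix (disjointEdgeGraph p) f e e' • pairIndicator e e' := by
      ext P
      change ∑ x ∈ P.1, ∑ y ∈ P.1, _ = _
      simp only [Finset.sum_apply, Pi.smul_apply, smul_eq_mul, pairIndicator, ite_and, mul_ite,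
        mul_one, mul_zero, sum_ite_irrel, sum_const_zero, sum_ite_mem, univ_inter]
    rw [this]
    refine Submodule.sum_mem _ fun e _ => Submodule.sum_mem _ fun e' _ => ?_
    by_cases h : (disjointEdgeGraph p).Adj e e'
    · exact Submodule.smul_mem _ _
        (Submodule.subset_span ⟨e, e', h.1, h.2.1, h.2.2.2.2, rfl⟩)
    · rw [edgeMatrix_of_not_adj f h, zero_smul]
      exact Submodule.zero_mem _
  · rintro _ ⟨e₁, e₂, h₁, h₂, hdisj, rfl⟩
    have key (e e' : Sym2 (Fin n)) (h : ¬ e.IsDiag) (h' : ¬ e'.IsDiag)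
        (hdisj : ∀ v, ¬ (v ∈ e ∧ v ∈ e')) (hp : p ∈ e') :
        pairIndicator e e' ∈ LinearMap.range (pairSum p) := by
      obtain ⟨a, rfl⟩ := hp
      exact pairIndicator_mem_range_of_notMem hn h (fun hp => hdisj p ⟨hp, Sym2.mem_mk_left p a⟩)
        (fun ha => hdisj a ⟨ha, Sym2.mem_mk_right p a⟩) (fun h => h' h.symm)
    by_cases hp₂ : p ∈ e₂
    · exact key e₁ e₂ h₁ h₂ hdisj hp₂
    by_cases hp₁ : p ∈ e₁
    · rw [pairIndicator_comm]
      exact key e₂ e₁ h₂ h₁ (fun v hv => hdisj v hv.symm) hp₁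
    exact pairIndicator_mem_range ⟨h₁, h₂, hp₁, hp₂, hdisj⟩

end pairIndicator

section kernelMatrix

variable {n : ℕ}

/-- The term of `kernelMatrix` depending on a single edge. -/
noncomputable def kernelWeight (T : Sym2 (Fin n) → ℝ) (e : Sym2 (Fin n)) : ℝ :=
  2 / (n - 4) * (T e - ∑ u ∈ e.toFinset, ∑ v, T s(u, v) + (n - 2 : ℝ)⁻¹ * ∑ u, ∑ v, T s(u, v))

/-- The symmetric matrix associated with weights `T` on the edges whose restriction to the edges
of `disjointEdgeGraph p` lies in the kernel of `pairSum p`. -/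
noncomputable def kernelMatrix (T : Sym2 (Fin n) → ℝ) (e e' : Sym2 (Fin n)) : ℝ :=
  ∑ u ∈ e.toFinset, ∑ v ∈ e'.toFinset, T s(u, v) + kernelWeight T e + kernelWeight T e'

theorem kernelMatrix_comm (T : Sym2 (Fin n) → ℝ) (e e' : Sym2 (Fin n)) :
    kernelMatrix T e e' = kernelMatrix T e' e := by
  rw [kernelMatrix, kernelMatrix, Finset.sum_comm, add_right_comm]
  congr 2
  exact sum_congr rfl fun u _ => sum_congr rfl fun v _ => by rw [Sym2.eq_swap]

theorem kernelMatrix_add (T T' : Sym2 (Fin n) → ℝ) (e e' : Sym2 (Fin n)) :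
    kernelMatrix (T + T') e e' = kernelMatrix T e e' + kernelMatrix T' e e' := by
  simp only [kernelMatrix, kernelWeight, Pi.add_apply, sum_add_distrib]
  ring

theorem kernelMatrix_smul (c : ℝ) (T : Sym2 (Fin n) → ℝ) (e e' : Sym2 (Fin n)) :
    kernelMatrix (c • T) e e' = c * kernelMatrix T e e' := by
  simp only [kernelMatrix, kernelWeight, Pi.smul_apply, smul_eq_mul, ← mul_sum]
  ring

/-- The restriction of `kernelMatrix` to the edges of `disjointEdgeGraph p`. -/
noncomputable def kernelVector (p : Fin n) :
    (Sym2 (Fin n) → ℝ) →ₗ[ℝ] ((disjointEdgeGraph p).edgeSet → ℝ) where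
  toFun T E := Sym2.lift ⟨kernelMatrix T, kernelMatrix_comm T⟩ E.1
  map_add' T T' := by
    ext ⟨E, hE⟩
    induction E with | _ e e'
    exact kernelMatrix_add T T' e e'
  map_smul' c T := by
    ext ⟨E, hE⟩
    induction E with | _ e e'
    exact kernelMatrix_smul c T e e'

theorem sum_toFinset_mk {a b : Fin n} (hab : a ≠ b) (φ : Fin n → ℝ) :
    ∑ u ∈ s(a, b).toFinset, φ u = φ a + φ b := by
  rw [Sym2.toFinset_mk_eq, sum_pair hab]

theorem IsPM.sum_sum_toFinset {P : Finset (Sym2 (Fin n))} (hP : IsPM P) (φ : Fin n → ℝ) :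
    ∑ e ∈ P, ∑ u ∈ e.toFinset, φ u = ∑ u, φ u := by
  rw [← sum_biUnion]
  · congr 1
    ext u
    obtain ⟨e, he, -⟩ := hP.2 u
    simpa using ⟨e, he⟩
  · intro e he e' he' hne
    refine disjoint_left.2 fun u hu hu' => hne ?_
    exact (hP.2 u).unique ⟨he, Sym2.mem_toFinset.1 hu⟩ ⟨he', Sym2.mem_toFinset.1 hu'⟩

theorem pairSum_kernelVector (hn : 5 ≤ n) {p : Fin n} {T : Sym2 (Fin n) → ℝ}
    (hdiag : ∀ u, T s(u, u) = 0) (hp : ∀ u, T s(p, u) = 0) : pairSum p (kernelVector p T) = 0 := by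
  ext P
  obtain ⟨P, hP⟩ := P
  obtain ⟨_, ⟨ha, ⟨a, rfl⟩⟩, -⟩ := hP.2 p
  have hpa : p ≠ a := fun h => hP.1 _ ha h
  set P' := P.erase s(p, a) with hP'
  have hsum (φ : Fin n → ℝ) : ∑ e ∈ P', ∑ u ∈ e.toFinset, φ u = ∑ u, φ u - φ p - φ a := by
    rw [hP', sum_erase_eq_sub ha, hP.sum_sum_toFinset, sum_toFinset_mk hpa]
    ring
  have htoFinset (e : Sym2 (Fin n)) (he : e ∈ P') : #e.toFinset = 2 :=
    Sym2.card_toFinset_of_not_isDiag e (hP.1 e (mem_of_mem_erase he))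
  have hcard : 2 * (#P' : ℝ) = n - 2 := by
    have := hsum fun _ => 1
    rw [sum_congr rfl fun e he => by rw [sum_const, htoFinset e he]] at this
    simp at this
    linarith
  set S := ∑ u, ∑ v, T s(u, v) with hS
  have hcross : ∑ e ∈ P', ∑ e' ∈ P', ∑ u ∈ e.toFinset, ∑ v ∈ e'.toFinset, T s(u, v) =
      S - 2 * ∑ v, T s(a, v) := by
    have h₁ : ∑ e ∈ P', ∑ e' ∈ P', ∑ u ∈ e.toFinset, ∑ v ∈ e'.toFinset, T s(u, v) =
        ∑ e ∈ P', ∑ u ∈ e.toFinset, (∑ v, T s(u, v) - T s(u, a)) := by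
      refine sum_congr rfl fun e _ => ?_
      rw [Finset.sum_comm]
      refine sum_congr rfl fun u _ => ?_
      rw [hsum, Sym2.eq_swap (a := u) (b := p), hp, sub_zero]
    rw [h₁, hsum, sum_sub_distrib, ← hS, hp, hdiag, sum_eq_zero fun u _ => hp u,
      sum_congr rfl fun u _ => by rw [Sym2.eq_swap]]
    ring
  have hdiagonal (e : Sym2 (Fin n)) (he : e ∈ P') :
      ∑ u ∈ e.toFinset, ∑ v ∈ e.toFinset, T s(u, v) = 2 * T e := by
    have := hP.1 e (mem_of_mem_erase he)
    induction e with | _ b c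
    rw [sum_toFinset_mk this, sum_toFinset_mk this, sum_toFinset_mk this, hdiag, hdiag,
      Sym2.eq_swap (a := c)]
    ring
  have hn4 : (n - 4 : ℝ) ≠ 0 := by
    have : (5 : ℝ) ≤ n := by exact_mod_cast hn
    linarith
  have hn2 : (n - 2 : ℝ) ≠ 0 := by
    have : (5 : ℝ) ≤ n := by exact_mod_cast hn
    linarith
  have hweight : (n - 4) * ∑ e ∈ P', kernelWeight T e =
      2 * ∑ e ∈ P', T e - S + 2 * ∑ v, T s(a, v) := by
    simp only [kernelWeight]
    rw [← mul_sum, sum_add_distrib, sum_sub_distrib, hsum, sum_const, nsmul_eq_mul, ← hS,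
      sum_eq_zero fun u _ => hp u, ← mul_assoc, mul_div_cancel₀ _ hn4]
    have : (#P' : ℝ) * ((n - 2 : ℝ)⁻¹ * S) = S / 2 := by
      rw [show (#P' : ℝ) = (n - 2) / 2 by linarith]
      field_simp
    rw [this]
    ring
  have hadj (e e' : Sym2 (Fin n)) (he : e ∈ P) (he' : e' ∈ P) :
      (disjointEdgeGraph p).Adj e e' ↔ e ∈ P' ∧ e' ∈ P' ∧ e ≠ e' := by
    have hmem (e : Sym2 (Fin n)) (he : e ∈ P) : e ∈ P' ↔ p ∉ e := by
      rw [hP', mem_erase]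
      refine ⟨fun h hpe => h.1 ((hP.2 p).unique ⟨he, hpe⟩ ⟨ha, Sym2.mem_mk_left p a⟩),
        fun h => ⟨?_, he⟩⟩
      rintro rfl
      exact h (Sym2.mem_mk_left p a)
    rw [disjointEdgeGraph_adj, hmem e he, hmem e' he']
    refine ⟨fun h => ⟨h.2.2.1, h.2.2.2.1, ?_⟩, fun h => ⟨hP.1 e he, hP.1 e' he', h.1, h.2.1, ?_⟩⟩
    · rintro rfl
      exact h.2.2.2.2 _ ⟨e.out_fst_mem, e.out_fst_mem⟩
    · exact fun v hv => h.2.2 ((hP.2 v).unique ⟨he, hv.1⟩ ⟨he', hv.2⟩)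
  have hentry (e e' : Sym2 (Fin n)) (he : e ∈ P) (he' : e' ∈ P) :
      edgeMatrix (disjointEdgeGraph p) (kernelVector p T) e e' =
        if e ∈ P' then (if e' ∈ P' then kernelMatrix T e e' else 0) -
          (if e' = e then kernelMatrix T e e else 0) else 0 := by
    by_cases h : (disjointEdgeGraph p).Adj e e'
    · rw [edgeMatrix_of_adj _ h]
      have := (hadj e e' he he').1 h
      rw [if_pos this.1, if_pos this.2.1, if_neg this.2.2.symm, sub_zero]
      rfl
    · rw [edgeMatrix_of_not_adj _ h]
      have := (hadj e e' he he').not.1 h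
      by_cases h₁ : e ∈ P'
      · by_cases h₂ : e = e'
        · subst h₂
          simp [h₁]
        · simp [h₁, Ne.symm h₂, show e' ∉ P' by tauto]
      · simp [h₁]
  have hinter : P ∩ P' = P' := inter_eq_right.2 (erase_subset _ _)
  have hinter' : P' ∩ P = P' := inter_eq_left.2 (erase_subset _ _)
  have htotal : ∑ e ∈ P', ∑ e' ∈ P', kernelMatrix T e e' =
      S - 2 * ∑ v, T s(a, v) + 2 * #P' * ∑ e ∈ P', kernelWeight T e := by
    simp only [kernelMatrix, sum_add_distrib, hcross, sum_const, nsmul_eq_mul, ← mul_sum]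
    ring
  have htrace : ∑ e ∈ P', kernelMatrix T e e =
      2 * ∑ e ∈ P', T e + 2 * ∑ e ∈ P', kernelWeight T e := by
    rw [mul_sum, mul_sum, ← sum_add_distrib]
    refine sum_congr rfl fun e he => ?_
    rw [kernelMatrix, hdiagonal e he]
    ring
  change ∑ e ∈ P, ∑ e' ∈ P, _ = _
  rw [sum_congr rfl fun e he => sum_congr rfl fun e' he' => hentry e e' he he']
  simp only [sum_ite_irrel, sum_const_zero, sum_sub_distrib, sum_ite_mem, sum_ite_eq', hinter,
    hinter']
  rw [htotal, htrace, hcard, Pi.zero_apply]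
  linear_combination hweight

theorem eq_zero_of_kernelVector_eq_zero (hn : 8 ≤ n) {p q r s : Fin n} {T : Sym2 (Fin n) → ℝ}
    (hpqrs : [p, q, r, s].Nodup) (hq : ∀ u, T s(u, q) = 0)
    (hrs : T s(r, s) = 0) (hT : kernelVector p T = 0) {x y : Fin n}
    (hnd : [p, q, x, y].Nodup) : T s(x, y) = 0 := by
  have hzero (a b c d : Fin n) (h : [p, a, b, c, d].Nodup) :
      kernelMatrix T s(a, b) s(c, d) = 0 :=
    congrFun hT ⟨s(s(a, b), s(c, d)), (SimpleGraph.mem_edgeSet _).2 (disjointEdgeGraph_adj_mk.2 h)⟩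
  rw [← hrs]
  refine eq_of_eq_of_move (s := fun v => v ∉ [p, q]) (φ := fun x y => T s(x, y))
      (x := x) (y := y) (z := r) (w := s) ?_ ?_ ?_ ?_ ?_ ?_ ?_ ?_
  · exact fun u v => congrArg _ Sym2.eq_swap
  · intro c x b hc hx hb hcx hbx hcb
    obtain ⟨d, hd⟩ := exists_notMem_of_length_lt [p, q, b, c, x] (by simp; omega)
    obtain ⟨y, hy⟩ := exists_notMem_of_length_lt [p, q, b, c, x, d] (by simp; omega)
    simp only [List.mem_cons, not_or] at hd hy hc hx hb
    have h₁ := hzero c d x y (by simp at hpqrs ⊢; grind)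
    have h₂ := hzero b d x y (by simp at hpqrs ⊢; grind)
    have h₃ := hzero c d q y (by simp at hpqrs ⊢; grind)
    have h₄ := hzero b d q y (by simp at hpqrs ⊢; grind)
    simp only [kernelMatrix] at h₁ h₂ h₃ h₄
    rw [sum_toFinset_mk (by tauto), sum_toFinset_mk (by tauto), sum_toFinset_mk (by tauto)]
      at h₁ h₂ h₃ h₄
    rw [hq, hq] at h₃ h₄
    linarith
  all_goals simp at hpqrs hnd ⊢; grind

end kernelMatrix

theorem card_le_finrank_ker_pairSum {n : ℕ} {p q r s : Fin n} (hn : 8 ≤ n)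
    (hpqrs : [p, q, r, s].Nodup) :
    Fintype.card (KernelIndex p q r s) ≤ Module.finrank ℝ (LinearMap.ker (pairSum p)) := by
  have hinj : Function.Injective (Subtype.val : KernelIndex p q r s → Sym2 (Fin n)) :=
    Subtype.val_injective
  set ext := Function.ExtendByZero.linearMap ℝ
    (Subtype.val : KernelIndex p q r s → Sym2 (Fin n))
  have hzero (t : KernelIndex p q r s → ℝ) (z : Sym2 (Fin n))
      (hz : ¬ (¬ z.IsDiag ∧ p ∉ z ∧ q ∉ z ∧ z ≠ s(r, s))) : ext t z = 0 :=
    Function.extend_apply' _ _ _ fun ⟨z', h⟩ => hz (h ▸ z'.2)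
  have hker (t : KernelIndex p q r s → ℝ) :
      (kernelVector p ∘ₗ ext) t ∈ LinearMap.ker (pairSum p) :=
    pairSum_kernelVector (by omega) (fun u => hzero t _ (by simp)) fun u => hzero t _ (by simp)
  rw [← Module.finrank_fintype_fun_eq_card ℝ]
  refine LinearMap.finrank_le_finrank_of_injective
    (f := (kernelVector p ∘ₗ ext).codRestrict (LinearMap.ker (pairSum p)) hker) ?_
  rw [← LinearMap.ker_eq_bot, LinearMap.ker_codRestrict, LinearMap.ker_eq_bot']
  intro t ht
  ext ⟨z, hz⟩
  have hval : ext t z = t ⟨z, hz⟩ := hinj.extend_apply t 0 ⟨z, hz⟩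
  rw [← hval]
  induction z with | _ x y
  exact eq_zero_of_kernelVector_eq_zero hn hpqrs (fun u => hzero t _ (by simp))
    (hzero t _ (by simp)) ht (by simp at hz hpqrs ⊢; grind)

theorem finrank_range_pairSum {n : ℕ} (hn : Even n) (hn8 : 8 ≤ n) (p : Fin n) :
    Module.finrank ℝ (LinearMap.range (pairSum p)) + ((n - 2).choose 2 - 1) =
      Fintype.card (disjointEdgeGraph p).edgeSet := by
  obtain ⟨q, hq⟩ := exists_notMem_of_length_lt [p] (by simp; omega)
  obtain ⟨r, hr⟩ := exists_notMem_of_length_lt [p, q] (by simp; omega)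
  obtain ⟨s, hs⟩ := exists_notMem_of_length_lt [p, q, r] (by simp; omega)
  have hpqrs : [p, q, r, s].Nodup := by simp at hq hr hs ⊢; grind
  rw [← card_kernelIndex hpqrs,
    (card_le_finrank_ker_pairSum hn8 hpqrs).antisymm (finrank_ker_pairSum_le hn hn8 hpqrs),
    LinearMap.finrank_range_add_finrank_ker, Module.finrank_fintype_fun_eq_card]

theorem eq_choose_formula_of_add_eq (k d J : ℕ) (hk : 4 ≤ k)
    (hJ : 2 * J = (2 * k - 1).choose 2 * (2 * k - 3).choose 2)
    (hd : d + ((2 * k - 2).choose 2 - 1) = J) :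
    d = 1 + (Nat.choose (2 * k) 2 - 2 * k) + (Nat.choose (2 * k) 4 - Nat.choose (2 * k) 3)
      + (2 * k) * (2 * k - 1) * (2 * k - 4) * (2 * k - 5) / 12 := by
  obtain ⟨m, rfl⟩ := Nat.exists_eq_add_of_le' hk
  obtain ⟨D, hD⟩ : 3 ∣ (m + 4) * (2 * m + 7) * (m + 2) * (2 * m + 3) := by
    have h (x : ZMod 3) : (x + 4) * (2 * x + 7) * (x + 2) * (2 * x + 3) = 0 := by
      revert x; decide
    rw [← ZMod.natCast_eq_zero_iff]
    simpa using h m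
  have h12 :
      (2 * (m + 4)) * (2 * (m + 4) - 1) * (2 * (m + 4) - 4) * (2 * (m + 4) - 5) / 12 = D := by
    rw [show 2 * (m + 4) - 1 = 2 * m + 7 by omega, show 2 * (m + 4) - 4 = 2 * (m + 2) by omega,
      show 2 * (m + 4) - 5 = 2 * m + 3 by omega]
    refine Nat.div_eq_of_eq_mul_right (by norm_num) ?_
    linear_combination 4 * hD
  rw [h12]
  rw [show 2 * (m + 4) - 1 = 2 * m + 7 by omega, show 2 * (m + 4) - 3 = 2 * m + 5 by omega] at hJ
  rw [show 2 * (m + 4) - 2 = 2 * m + 6 by omega] at hd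
  rw [show 2 * (m + 4) = 2 * m + 8 by omega]
  have hchoose (j : ℕ) : (2 * j + 1).choose 2 = (2 * j + 1) * j := by
    rw [Nat.choose_two_right]
    exact Nat.div_eq_of_eq_mul_right (by norm_num) (by simp; ring)
  have h₁ : (2 * m + 6).choose 2 = (m + 3) * (2 * m + 5) := by
    rw [Nat.choose_two_right]
    exact Nat.div_eq_of_eq_mul_right (by norm_num) (by simp; ring)
  have h₂ : (2 * m + 8).choose 2 = (m + 4) * (2 * m + 7) := by
    rw [Nat.choose_two_right]
    exact Nat.div_eq_of_eq_mul_right (by norm_num) (by simp; ring)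
  have h₃ : (2 * m + 8).choose 3 * 3 = (m + 4) * (2 * m + 7) * (2 * m + 6) := by
    rw [← h₂]; exact Nat.choose_succ_right_eq _ 2
  have h₄ : (2 * m + 8).choose 4 * 4 = (2 * m + 8).choose 3 * (2 * m + 5) :=
    Nat.choose_succ_right_eq _ 3
  rw [show 2 * m + 7 = 2 * (m + 3) + 1 by ring, show 2 * m + 5 = 2 * (m + 2) + 1 by ring, hchoose,
    hchoose] at hJ
  rw [h₁] at hd
  rw [h₂]
  set a := (2 * m + 8).choose 3
  set b := (2 * m + 8).choose 4
  have hab : a ≤ b := by nlinarith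
  obtain ⟨c, hc⟩ := Nat.exists_eq_add_of_le hab
  have e₁ : (m + 4) * (2 * m + 7) - (2 * m + 8) = (m + 4) * (2 * m + 5) := by
    rw [Nat.sub_eq_iff_eq_add (by nlinarith)]; ring
  have e₂ : (m + 3) * (2 * m + 5) - 1 = (m + 2) * (2 * m + 7) := by
    rw [Nat.sub_eq_iff_eq_add (by nlinarith)]; ring
  rw [e₁, hc, Nat.add_sub_cancel_left]
  rw [e₂] at hd
  rw [hc] at h₄
  qify at hd hJ hD h₃ h₄ ⊢
  linear_combination hd + hJ / 2 + hD / 3 - h₄ / 4 - (2 * m + 1) / 12 * h₃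

/-- Let `k ≥ 4`.  For disjoint (non-loop, vertex-disjoint) edges `e₁, e₂` of `K_{2k}`, let
`ν_{e₁,e₂}` be the 0/1 vector, indexed by the perfect matchings of `K_{2k}`, whose entry at
`P` is `1` exactly when `P` contains both `e₁` and `e₂`.  The real span of all these vectors
has dimension `1 + (C(2k,2) - 2k) + (C(2k,4) - C(2k,3)) + (2k)(2k-1)(2k-4)(2k-5)/12`. -/
theorem dim_span_pairs_of_edges (k : ℕ) (hk : 4 ≤ k) :
    Module.finrank ℝ (Submodule.span ℝ
      {ν : PM (2 * k) → ℝ | ∃ e₁ e₂ : Sym2 (Fin (2 * k)),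
        ¬ e₁.IsDiag ∧ ¬ e₂.IsDiag ∧ (∀ v : Fin (2 * k), ¬ (v ∈ e₁ ∧ v ∈ e₂)) ∧
        ν = fun P : PM (2 * k) => if e₁ ∈ P.1 ∧ e₂ ∈ P.1 then (1 : ℝ) else 0}) =
    1 + (Nat.choose (2 * k) 2 - 2 * k) + (Nat.choose (2 * k) 4 - Nat.choose (2 * k) 3)
      + (2 * k) * (2 * k - 1) * (2 * k - 4) * (2 * k - 5) / 12 := by
  have h := finrank_range_pairSum (even_two_mul k) (by omega) (⟨0, by omega⟩ : Fin (2 * k))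
  rw [range_pairSum (by omega)] at h
  exact eq_choose_formula_of_add_eq k _ _ hk (two_mul_card_edgeSet _) h
end

section
/- Let k ≥ 2, let e be an edge of K_{2k}, and let P be a perfect matching of K_{2k} with e ∉ P. Then the number of perfect matchings Q of K_{2k} such that e ∈ Q, Q has no edge in common with P, and the graph on {1,…,2k} with edge set P ∪ Q is connected, equals (2k−4)!!. -/
/-- `q` is an involution with the same fixed points as `p`, and `p` and `q` together act
transitively on the points they move. -/
structure IsHamPartner {V : Type*} (p q : Equiv.Perm V) : Prop where
  invol : ∀ v, q (q v) = v
  fixed_iff : ∀ v, q v = v ↔ p v = v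
  conn : ∀ T : Set V, (∀ v ∈ T, p v ∈ T) → (∀ v ∈ T, q v ∈ T) →
    (∃ x ∈ T, p x ≠ x) → ∀ y, p y ≠ y → y ∈ T

namespace IsHamPartner

open Equiv

variable {V : Type*} [DecidableEq V]

/-- Given an involution `p` with `p a ≠ b`, remove the points `a` and `b` and join `p a` to `p b`. -/
def contract (p : Perm V) (a b : V) : Perm V :=
  p * swap a (p a) * swap b (p b) * swap (p a) (p b)

theorem contract_apply {p : Perm V} (hp : ∀ v, p (p v) = v) {a b : V} (ha : p a ≠ a)
    (hb : p b ≠ b) (hab : a ≠ b) (hpab : p a ≠ b) (v : V) :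
    contract p a b v = if v = a then a else if v = b then b else if v = p a then p b
      else if v = p b then p a else p v := by
  have h1 : p a ≠ p b := fun h => hab (p.injective h)
  have h2 := hp a
  have h3 := hp b
  simp only [contract, Perm.mul_apply, swap_apply_def]
  grind

theorem contract_invol {p : Perm V} (hp : ∀ v, p (p v) = v) {a b : V} (ha : p a ≠ a)
    (hb : p b ≠ b) (hab : a ≠ b) (hpab : p a ≠ b) (v : V) :
    contract p a b (contract p a b v) = v := by
  have h1 : p a ≠ p b := fun h => hab (p.injective h)
  have h2 := hp a
  have h3 := hp b
  have h4 := hp v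
  simp only [contract_apply hp ha hb hab hpab]
  grind

theorem contract_fixed_iff {p : Perm V} (hp : ∀ v, p (p v) = v) {a b : V} (ha : p a ≠ a)
    (hb : p b ≠ b) (hab : a ≠ b) (hpab : p a ≠ b) (v : V) :
    contract p a b v = v ↔ v = a ∨ v = b ∨ p v = v := by
  have h1 : p a ≠ p b := fun h => hab (p.injective h)
  have h2 := hp a
  have h3 := hp b
  simp only [contract_apply hp ha hb hab hpab]
  grind

theorem contract_mul_swap {p q : Perm V} (hp : ∀ v, p (p v) = v) {a b : V} (ha : p a ≠ a)
    (hb : p b ≠ b) (hab : a ≠ b) (hpab : p a ≠ b) (h : IsHamPartner p q) (hq : q a = b) :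
    IsHamPartner (contract p a b) (q * swap a b) := by
  have hqb : q b = a := by rw [← hq, h.invol]
  have hmul : ∀ v, (q * swap a b) v = if v = a then a else if v = b then b else q v := by
    intro v
    simp only [Perm.mul_apply, swap_apply_def]
    grind
  have hc := contract_apply hp ha hb hab hpab
  have hpab' : p a ≠ p b := fun h => hab (p.injective h)
  have hpa := hp a
  have hpb := hp b
  refine ⟨fun v => ?_, fun v => ?_, fun T hTp hTq ⟨x, hxT, hx⟩ y hy => ?_⟩
  · have := h.invol v
    rw [hmul, hmul]
    grind
  · rw [contract_fixed_iff hp ha hb hab hpab, hmul]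
    have := h.fixed_iff v
    grind
  · rw [Ne, contract_fixed_iff hp ha hb hab hpab] at hx hy
    push Not at hx hy
    let T' : Set V := {v | if v = a ∨ v = b then p a ∈ T else v ∈ T}
    have hTpab : p a ∈ T ↔ p b ∈ T := by
      have h1 := hTp (p a)
      have h2 := hTp (p b)
      rw [hc] at h1 h2
      grind
    have key := h.conn T' (fun v hv => ?_) (fun v hv => ?_) ⟨x, ?_, hx.2.2⟩ y hy.2.2
    · simpa [T', hy.1, hy.2.1] using key
    · have h1 := hTp v
      have h2 := hp v
      rw [hc] at h1
      simp only [T', Set.mem_ofPred_eq] at hv ⊢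
      grind
    · have h1 := hTq v
      have h2 := h.invol v
      rw [hmul] at h1
      simp only [T', Set.mem_ofPred_eq] at hv ⊢
      grind
    · simpa [T', hx.1, hx.2.1] using hxT

theorem of_contract {p q : Perm V} (hp : ∀ v, p (p v) = v) {a b : V} (ha : p a ≠ a)
    (hb : p b ≠ b) (hab : a ≠ b) (hpab : p a ≠ b) (h : IsHamPartner (contract p a b) q) :
    IsHamPartner p (q * swap a b) ∧ (q * swap a b) a = b := by
  have hfix := contract_fixed_iff hp ha hb hab hpab
  have hqa : q a = a := (h.fixed_iff a).2 ((hfix a).2 (.inl rfl))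
  have hqb : q b = b := (h.fixed_iff b).2 ((hfix b).2 (.inr (.inl rfl)))
  have hmul : ∀ v, (q * swap a b) v = if v = a then b else if v = b then a else q v := by
    intro v
    simp only [Perm.mul_apply, swap_apply_def]
    grind
  have hc := contract_apply hp ha hb hab hpab
  have hpab' : p a ≠ p b := fun h => hab (p.injective h)
  have hpa := hp a
  have hpb := hp b
  refine ⟨⟨fun v => ?_, fun v => ?_, fun T hTp hTq ⟨x, hxT, hx⟩ y hy => ?_⟩, by simp [hqb]⟩
  · have := h.invol v
    rw [hmul, hmul]
    grind
  · have h1 := h.fixed_iff v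
    rw [hfix] at h1
    rw [hmul]
    grind
  · have hTab : a ∈ T ↔ b ∈ T := by
      have h1 := hTq a
      have h2 := hTq b
      rw [hmul] at h1 h2
      grind
    have hTa : a ∈ T ↔ p a ∈ T := ⟨hTp a, fun h => hpa ▸ hTp _ h⟩
    have hTb : b ∈ T ↔ p b ∈ T := ⟨hTp b, fun h => hpb ▸ hTp _ h⟩
    have key := h.conn T (fun v hv => ?_) (fun v hv => ?_) ?_
    · have h1 := key (p a) (by rw [Ne, hfix]; grind)
      have h2 := key y
      rw [Ne, hfix] at h2
      grind
    · have := hTp v hv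
      rw [hc]
      grind
    · have := hTq v hv
      rw [hmul] at this
      grind
    · by_cases hxab : x = a ∨ x = b
      · exact ⟨p a, by grind, by rw [Ne, hfix]; grind⟩
      · exact ⟨x, hxT, by rw [Ne, hfix]; grind⟩

open Classical in
theorem card_apply_eq [Fintype V] {p : Perm V} (hp : ∀ v, p (p v) = v) {a b : V}
    (ha : p a ≠ a) (hb : p b ≠ b) (hab : a ≠ b) (hpab : p a ≠ b) :
    (Finset.univ.filter fun q => IsHamPartner p q ∧ q a = b).card =
      (Finset.univ.filter fun q => IsHamPartner (contract p a b) q).card := by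
  refine Finset.card_nbij' (· * swap a b) (· * swap a b) (fun q hq => ?_) (fun q hq => ?_)
    (fun q _ => by simp) (fun q _ => by simp)
  · simp only [Finset.coe_filter, Finset.mem_univ, true_and, Set.mem_ofPred_eq] at hq ⊢
    exact contract_mul_swap hp ha hb hab hpab hq.1 hq.2
  · simp only [Finset.coe_filter, Finset.mem_univ, true_and, Set.mem_ofPred_eq] at hq ⊢
    exact of_contract hp ha hb hab hpab hq

theorem card_support_contract [Fintype V] {p : Perm V} (hp : ∀ v, p (p v) = v) {a b : V}
    (ha : p a ≠ a) (hb : p b ≠ b) (hab : a ≠ b) (hpab : p a ≠ b) :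
    (contract p a b).support.card = p.support.card - 2 := by
  have : (contract p a b).support = p.support \ {a, b} := by
    ext v
    simp only [Perm.mem_support, Ne, contract_fixed_iff hp ha hb hab hpab, Finset.mem_sdiff,
      Finset.mem_insert, Finset.mem_singleton]
    tauto
  rw [this, Finset.card_sdiff_of_subset, Finset.card_pair hab]
  intro v hv
  simp only [Finset.mem_insert, Finset.mem_singleton] at hv
  rcases hv with rfl | rfl <;> simpa

theorem apply_ne [Fintype V] {p q : Perm V} (hp : ∀ v, p (p v) = v)
    (h : IsHamPartner p q) (hcard : 2 < p.support.card) {a : V} (ha : p a ≠ a) :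
    q a ≠ p a := by
  intro hq
  have hq' := h.invol a
  have hpa := hp a
  have hsub : p.support ⊆ {a, p a} := fun y hy => by
    have := h.conn {a, p a} (by grind) (by grind) ⟨a, by simp, ha⟩ y (by simpa using hy)
    simpa using this
  have := (Finset.card_le_card hsub).trans Finset.card_le_two
  omega

theorem eq_of_card_support [Fintype V] {p q : Perm V}
    (hq : ∀ v, q v = v ↔ p v = v) (hcard : p.support.card = 2) : q = p := by
  ext v
  by_cases hv : p v = v
  · rw [hv, (hq v).2 hv]
  · have hsub : ({v, p v} : Finset V) ⊆ p.support := by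
      intro y hy
      simp only [Finset.mem_insert, Finset.mem_singleton] at hy
      rcases hy with rfl | rfl
      · simpa using hv
      · simpa using hv
    have heq := Finset.eq_of_subset_of_card_le hsub (by rw [hcard, Finset.card_pair (Ne.symm hv)])
    have hqv : q v ≠ v := fun h => hv ((hq v).1 h)
    have hmem : q v ∈ p.support := by
      rw [Perm.mem_support, Ne, ← hq]
      exact fun h => hqv (q.injective h)
    rw [← heq] at hmem
    simpa [hqv] using hmem

theorem self_of_card_support [Fintype V] {p : Perm V} (hp : ∀ v, p (p v) = v)
    (hcard : p.support.card = 2) : IsHamPartner p p := by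
  refine ⟨hp, fun _ => Iff.rfl, fun T hT _ ⟨x, hxT, hx⟩ y hy => ?_⟩
  have hsub : ({x, p x} : Finset V) ⊆ p.support := by
    intro y hy
    simp only [Finset.mem_insert, Finset.mem_singleton] at hy
    rcases hy with rfl | rfl <;> simpa using hx
  have heq := Finset.eq_of_subset_of_card_le hsub (by rw [hcard, Finset.card_pair (Ne.symm hx)])
  have hmem : y ∈ p.support := by simpa using hy
  rw [← heq] at hmem
  simp only [Finset.mem_insert, Finset.mem_singleton] at hmem
  rcases hmem with rfl | rfl
  exacts [hxT, hT _ hxT]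

open Classical in
theorem card_eq_doubleFactorial [Fintype V] (m : ℕ) (p : Perm V) (hp : ∀ v, p (p v) = v)
    (hcard : p.support.card = 2 * m + 2) :
    (Finset.univ.filter fun q => IsHamPartner p q).card = Nat.doubleFactorial (2 * m) := by
  induction m generalizing p with
  | zero =>
    rw [Nat.mul_zero, Nat.doubleFactorial, Finset.card_eq_one]
    refine ⟨p, Finset.ext fun q => ?_⟩
    simp only [Finset.mem_filter, Finset.mem_univ, true_and, Finset.mem_singleton]
    refine ⟨fun h => eq_of_card_support h.fixed_iff hcard, ?_⟩
    rintro rfl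
    exact self_of_card_support hp hcard
  | succ m ih =>
    obtain ⟨a, ha⟩ : p.support.Nonempty := by
      rw [← Finset.card_pos]
      omega
    have ha' : p a ≠ a := by simpa using ha
    have hpa : p a ∈ p.support := by simpa using ha
    have hmaps : ∀ q ∈ Finset.univ.filter fun q => IsHamPartner p q,
        q a ∈ p.support \ {a, p a} := by
      intro q hq
      have h : IsHamPartner p q := by simpa using hq
      have hqa : q a ≠ a := fun e => ha' ((h.fixed_iff a).1 e)
      have hqs : p (q a) ≠ q a := fun e => hqa (q.injective ((h.fixed_iff _).2 e))
      simp [hqa, hqs, h.apply_ne hp (by omega) ha']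
    rw [Finset.card_eq_sum_card_fiberwise hmaps, Finset.sum_congr rfl fun b hb => ?_,
      Finset.sum_const, Finset.card_sdiff_of_subset (by grind), Finset.card_pair ha'.symm, hcard,
      smul_eq_mul, show 2 * (m + 1) = 2 * m + 2 by ring, Nat.doubleFactorial, Nat.add_sub_cancel]
    simp only [Finset.mem_sdiff, Perm.mem_support, Finset.mem_insert, Finset.mem_singleton,
      not_or] at hb
    obtain ⟨hb, hba, hbp⟩ := hb
    rw [Finset.filter_filter, card_apply_eq hp ha' hb (Ne.symm hba) (Ne.symm hbp)]
    refine ih _ (contract_invol hp ha' hb (Ne.symm hba) (Ne.symm hbp)) ?_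
    rw [card_support_contract hp ha' hb (Ne.symm hba) (Ne.symm hbp), hcard]
    omega

end IsHamPartner

namespace IsPM

open Equiv

variable {n : ℕ}

/-- The set of edges `{v, q v}`. -/
def edgesOf (q : Perm (Fin n)) : Finset (Sym2 (Fin n)) :=
  Finset.univ.image fun v => s(v, q v)

theorem mk_mem_edgesOf {q : Perm (Fin n)} (hq : ∀ v, q (q v) = v) {v w : Fin n} :
    s(v, w) ∈ edgesOf q ↔ q v = w := by
  have := hq v
  have := hq w
  simp only [edgesOf, Finset.mem_image, Finset.mem_univ, true_and, Sym2.eq_iff]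
  grind

theorem edgesOf_isPM {q : Perm (Fin n)} (hq : ∀ v, q (q v) = v) (hfix : ∀ v, q v ≠ v) :
    IsPM (edgesOf q) := by
  refine ⟨fun e => ?_, fun v => ⟨s(v, q v), ⟨(mk_mem_edgesOf hq).2 rfl, Sym2.mem_mk_left _ _⟩, ?_⟩⟩
  · induction e with
    | h v w =>
      rw [mk_mem_edgesOf hq, Sym2.mk_isDiag_iff]
      rintro rfl h
      exact hfix v h.symm
  · rintro e ⟨he, w, rfl⟩
    rw [mk_mem_edgesOf hq] at he
    rw [he]

theorem exists_edgesOf_eq {Q : Finset (Sym2 (Fin n))} (hQ : IsPM Q) :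
    ∃ q : Perm (Fin n), (∀ v, q (q v) = v) ∧ (∀ v, q v ≠ v) ∧ edgesOf q = Q := by
  have hex : ∀ v, ∃ w, s(v, w) ∈ Q := fun v => by
    obtain ⟨e, ⟨he, w, rfl⟩, -⟩ := hQ.2 v
    exact ⟨w, he⟩
  choose f hf using hex
  have huniq : ∀ v w, s(v, w) ∈ Q → f v = w := fun v w h =>
    Sym2.congr_right.1 ((hQ.2 v).unique ⟨hf v, Sym2.mem_mk_left _ _⟩ ⟨h, Sym2.mem_mk_left _ _⟩)
  have hinv : Function.Involutive f := fun v => huniq _ _ (Sym2.eq_swap ▸ hf v)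
  refine ⟨hinv.toPerm, hinv, fun v h => hQ.1 _ (hf v) ?_, Finset.ext fun e => ?_⟩
  · exact Sym2.mk_isDiag_iff.2 h.symm
  · induction e with
    | h v w =>
      rw [mk_mem_edgesOf (q := hinv.toPerm) hinv]
      exact ⟨fun h => h ▸ hf v, huniq v w⟩

theorem edgesOf_injective {p q : Perm (Fin n)} (hp : ∀ v, p (p v) = v) (hq : ∀ v, q (q v) = v)
    (h : edgesOf p = edgesOf q) : p = q := by
  ext1 v
  exact ((mk_mem_edgesOf hq).1 (h ▸ (mk_mem_edgesOf hp).2 rfl)).symm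

theorem connected_iff [Nonempty (Fin n)] {p q : Perm (Fin n)} (hp : ∀ v, p (p v) = v)
    (hq : ∀ v, q (q v) = v) (hpfix : ∀ v, p v ≠ v) (hqfix : ∀ v, q v ≠ v) :
    (SimpleGraph.fromEdgeSet
      (↑(edgesOf p ∪ edgesOf q) : Set (Sym2 (Fin n)))).Connected ↔ IsHamPartner p q := by
  have hadj : ∀ v w, (SimpleGraph.fromEdgeSet
      (↑(edgesOf p ∪ edgesOf q) : Set (Sym2 (Fin n)))).Adj v w ↔ (p v = w ∨ q v = w) := by
    intro v w
    simp only [SimpleGraph.fromEdgeSet_adj, Finset.coe_union, Set.mem_union, Finset.mem_coe,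
      mk_mem_edgesOf hp, mk_mem_edgesOf hq]
    have := hpfix v
    have := hqfix v
    grind
  constructor
  · intro h
    refine ⟨hq, fun v => by simp [hpfix, hqfix], fun T hTp hTq ⟨x, hxT, hx⟩ y hy => ?_⟩
    clear hx hy
    obtain ⟨W⟩ := h.preconnected x y
    induction W with
    | nil => exact hxT
    | cons hvw _ ih =>
      refine ih ?_
      rcases (hadj _ _).1 hvw with rfl | rfl
      exacts [hTp _ hxT, hTq _ hxT]
  · intro h
    refine ⟨fun x y => ?_⟩
    exact h.conn {w | (SimpleGraph.fromEdgeSet _).Reachable x w}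
      (fun v hv => hv.trans ((hadj _ _).2 (.inl rfl)).reachable)
      (fun v hv => hv.trans ((hadj _ _).2 (.inr rfl)).reachable)
      ⟨x, SimpleGraph.Reachable.refl _, hpfix x⟩ y (hpfix y)

end IsPM

/-- Let `k ≥ 2`, let `e` be an edge of `K_{2k}` and let `P` be a perfect matching of `K_{2k}`
with `e ∉ P`.  The number of perfect matchings `Q` of `K_{2k}` with `e ∈ Q`, sharing no edge
with `P`, such that the graph on the `2k` vertices with edge set `P ∪ Q` is connected,
equals `(2k-4)!!`. -/
theorem card_hamiltonian_partners_through_edge (k : ℕ) (hk : 2 ≤ k)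
    (e : Sym2 (Fin (2 * k))) (he : ¬ e.IsDiag)
    (P : Finset (Sym2 (Fin (2 * k)))) (hP : IsPM P) (heP : e ∉ P) :
    Nat.card {Q : Finset (Sym2 (Fin (2 * k))) // IsPM Q ∧ e ∈ Q ∧ P ∩ Q = ∅ ∧
        (SimpleGraph.fromEdgeSet (↑(P ∪ Q) : Set (Sym2 (Fin (2 * k))))).Connected} =
      Nat.doubleFactorial (2 * k - 4) := by
  classical
  have : NeZero (2 * k) := ⟨by omega⟩
  obtain ⟨p, hp, hpfix, rfl⟩ := hP.exists_edgesOf_eq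
  induction e with
  | h a b =>
  rw [Sym2.mk_isDiag_iff] at he
  rw [IsPM.mk_mem_edgesOf hp] at heP
  have hsupp : p.support.card = 2 * k := by
    rw [Finset.eq_univ_of_forall fun v => Equiv.Perm.mem_support.2 (hpfix v), Finset.card_univ,
      Fintype.card_fin]
  have hcount : (Finset.univ.filter fun q => IsHamPartner p q ∧ q a = b).card =
      Nat.doubleFactorial (2 * k - 4) := by
    rw [IsHamPartner.card_apply_eq hp (hpfix a) (hpfix b) he heP,
      IsHamPartner.card_eq_doubleFactorial (k - 2) _
        (IsHamPartner.contract_invol hp (hpfix a) (hpfix b) he heP), Nat.mul_sub]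
    rw [IsHamPartner.card_support_contract hp (hpfix a) (hpfix b) he heP, hsupp]
    omega
  rw [← hcount, ← Fintype.card_subtype, ← Nat.card_eq_fintype_card]
  have hmaps : ∀ q : {q : Equiv.Perm (Fin (2 * k)) // IsHamPartner p q ∧ q a = b},
      IsPM (IsPM.edgesOf q.1) ∧ s(a, b) ∈ IsPM.edgesOf q.1 ∧
        IsPM.edgesOf p ∩ IsPM.edgesOf q.1 = ∅ ∧ (SimpleGraph.fromEdgeSet
          (↑(IsPM.edgesOf p ∪ IsPM.edgesOf q.1) : Set (Sym2 (Fin (2 * k))))).Connected := by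
    rintro ⟨q, h, hq⟩
    have hqfix : ∀ v, q v ≠ v := fun v hv => hpfix v ((h.fixed_iff v).1 hv)
    refine ⟨IsPM.edgesOf_isPM h.invol hqfix, (IsPM.mk_mem_edgesOf h.invol).2 hq, ?_,
      (IsPM.connected_iff hp h.invol hpfix hqfix).2 h⟩
    refine Finset.eq_empty_of_forall_notMem fun e => ?_
    induction e with
    | h v w =>
      rw [Finset.mem_inter, IsPM.mk_mem_edgesOf hp, IsPM.mk_mem_edgesOf h.invol]
      rintro ⟨rfl, hvw⟩
      exact h.apply_ne hp (by omega) (hpfix v) hvw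
  refine (Nat.card_congr (Equiv.ofBijective (fun q => ⟨IsPM.edgesOf q.1, hmaps q⟩) ⟨?_, ?_⟩)).symm
  · rintro ⟨q, h, hq⟩ ⟨q', h', hq'⟩ heq
    exact Subtype.ext (IsPM.edgesOf_injective h.invol h'.invol (congrArg Subtype.val heq))
  · rintro ⟨Q, hQ, heQ, -, hconn⟩
    obtain ⟨q, hq, hqfix, rfl⟩ := hQ.exists_edgesOf_eq
    exact ⟨⟨q, (IsPM.connected_iff hp hq hpfix hqfix).1 hconn, (IsPM.mk_mem_edgesOf hq).1 heQ⟩, rfl⟩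
end
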